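/- Let p be any odd prime. Then ∑_{k=0}^{p-1} (-1)^k A_k(-2) ≡ ∑_{k=0}^{p-1} (-1)^k A_k(1/4) (mod p²) (the second sum taken in ℤ_p, where 4 is invertible), and both sums are congruent modulo p² to: 4x² - 2p if p ≡ 1 (mod 4) and p = x² + y² with x odd and y even; and to 0 if p ≡ 3 (mod 4). -/

import Mathlib

/-- The Apéry polynomial `A_n(x) = ∑_{k=0}^n C(n,k)² C(n+k,k)² x^k`. -/
noncomputable def aperyPoly {R : Type*} [CommRing R] (n : ℕ) (x : R) : R :=
  ∑ k ∈ Finset.range (n + 1), (n.choose k : R) ^ 2 * ((n + k).choose k : R) ^ 2 * x ^ k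

open Finset

theorem cast_choose_succ_mul {R : Type*} [CommRing R] (n k : ℕ) :
    (n.choose (k + 1) : R) * (k + 1) = n.choose k * (n - k) := by
  have h := congrArg (Nat.cast : ℕ → R) (Nat.choose_succ_right_eq n k)
  push_cast at h
  rw [h]
  rcases le_or_gt k n with hk | hk
  · rw [Nat.cast_sub hk]
  · simp [Nat.choose_eq_zero_of_lt hk]

theorem cast_succ_choose_succ_mul {R : Type*} [CommRing R] (n k : ℕ) :
    ((n + 1).choose (k + 1) : R) * (k + 1) = (n + 1) * n.choose k := by
  have h := congrArg (Nat.cast : ℕ → R) (Nat.add_one_mul_choose_eq n k)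
  push_cast at h
  exact h.symm

theorem sum_neg_one_pow_mul_choose_sq (k N : ℕ) :
    8 * ((k : ℤ) + 1) ^ 2 * ∑ n ∈ range N, (-1) ^ n * ((n + k + 1).choose (2 * k + 2) : ℤ) ^ 2 -
      (2 * k + 1) * (k + 1) * ∑ n ∈ range N, (-1) ^ n * ((n + k).choose (2 * k) : ℤ) ^ 2 =
    -((-1) ^ N * ((N : ℤ) ^ 2 - (k + 1) * (3 * k + 2)) *
      ((N + k).choose (2 * k + 1) : ℤ) ^ 2) := by
  induction N with
  | zero => simp [Nat.choose_eq_zero_of_lt (show k < 2 * k + 1 by omega)]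
  | succ N ih =>
    rw [sum_range_succ, sum_range_succ]
    have h1 := cast_choose_succ_mul (R := ℤ) (N + k) (2 * k)
    have h2 := cast_succ_choose_succ_mul (R := ℤ) (N + k) (2 * k)
    have h3 := cast_succ_choose_succ_mul (R := ℤ) (N + k) (2 * k + 1)
    rw [show N + 1 + k = N + k + 1 by ring, pow_succ]
    rw [show 2 * k + 1 + 1 = 2 * k + 2 by ring] at h3
    push_cast at *
    generalize ((N + k).choose (2 * k) : ℤ) = a at *
    generalize ((N + k).choose (2 * k + 1) : ℤ) = b at *
    generalize ((N + k + 1).choose (2 * k + 1) : ℤ) = b' at *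
    generalize ((N + k + 1).choose (2 * k + 2) : ℤ) = a' at *
    have key : 8 * ((k : ℤ) + 1) ^ 2 * a' ^ 2 - (2 * k + 1) * (k + 1) * a ^ 2 =
        (((N : ℤ) + 1) ^ 2 - (k + 1) * (3 * k + 2)) * b' ^ 2 +
          ((N : ℤ) ^ 2 - (k + 1) * (3 * k + 2)) * b ^ 2 := by
      have h0 : (2 * (k : ℤ) + 1) ^ 2 ≠ 0 := by positivity
      apply mul_left_cancel₀ h0
      have e1 : (2 * (k : ℤ) + 1) ^ 2 * b ^ 2 = (a * (N - k)) ^ 2 := by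
        linear_combination (b * (2 * k + 1) + a * (N + k - 2 * k)) * h1
      have e2 : (2 * (k : ℤ) + 1) ^ 2 * b' ^ 2 = ((N + k + 1) * a) ^ 2 := by
        linear_combination (b' * (2 * k + 1) + (N + k + 1) * a) * h2
      have e3 : 4 * ((k : ℤ) + 1) ^ 2 * a' ^ 2 = ((N + k + 1) * b) ^ 2 := by
        linear_combination (a' * (2 * k + 1 + 1) + (N + k + 1) * b) * h3
      linear_combination 2 * (2 * (k : ℤ) + 1) ^ 2 * e3 +
        (2 * ((N : ℤ) + k + 1) ^ 2 - ((N : ℤ) ^ 2 - (k + 1) * (3 * k + 2))) * e1 -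
        (((N : ℤ) + 1) ^ 2 - (k + 1) * (3 * k + 2)) * e2
    linear_combination ih + (-1) ^ N * key

/-- Natural numbers prime to `p` are units modulo `p ^ 2`. -/
theorem isUnit_natCast_zmod_sq {p a : ℕ} (hp : p.Prime) (ha : ¬ p ∣ a) :
    IsUnit (a : ZMod (p ^ 2)) := by
  rw [ZMod.isUnit_iff_coprime]
  exact ((Nat.Prime.coprime_iff_not_dvd hp).2 ha).symm.pow_right 2

theorem isUnit_natCast_zmod_sq_of_lt {p a : ℕ} (hp : p.Prime) (h0 : 0 < a) (ha : a < p) :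
    IsUnit (a : ZMod (p ^ 2)) :=
  isUnit_natCast_zmod_sq hp fun h => absurd (Nat.le_of_dvd h0 h) (by omega)

theorem natCast_sq_eq_zero_zmod_sq (p : ℕ) : (p : ZMod (p ^ 2)) ^ 2 = 0 := by
  exact_mod_cast ZMod.natCast_self (p ^ 2)

theorem natCast_sq_eq_zero_of_dvd {p a : ℕ} (h : p ∣ a) : (a : ZMod (p ^ 2)) ^ 2 = 0 := by
  obtain ⟨c, rfl⟩ := h
  push_cast
  rw [mul_pow, natCast_sq_eq_zero_zmod_sq, zero_mul]

theorem sum_neg_one_pow_mul_choose_sq_zmod {p m : ℕ} (hp : p.Prime) (hm : p = 2 * m + 1)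
    {k : ℕ} (hk : k ≤ m) :
    ∑ n ∈ range p, (-1 : ZMod (p ^ 2)) ^ n * ((n + k).choose (2 * k) : ZMod (p ^ 2)) ^ 2 =
      (-1) ^ k * ((m + k).choose (2 * k) : ZMod (p ^ 2)) := by
  induction k with
  | zero =>
    simp only [Nat.mul_zero, Nat.choose_zero_right, Nat.cast_one, one_pow, mul_one, pow_zero, hm]
    clear hk hm
    induction m with
    | zero => simp
    | succ m ih =>
      rw [show 2 * (m + 1) + 1 = 2 * m + 1 + 1 + 1 by ring, sum_range_succ, sum_range_succ, ih,
        pow_succ]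
      ring
  | succ k ih =>
    specialize ih (by omega)
    have h := congrArg (Int.cast : ℤ → ZMod (p ^ 2)) (sum_neg_one_pow_mul_choose_sq k p)
    have h0 : ((p + k).choose (2 * k + 1) : ZMod (p ^ 2)) ^ 2 = 0 :=
      natCast_sq_eq_zero_of_dvd (hp.dvd_choose (by omega) (by omega) (by omega))
    push_cast at h
    rw [h0, mul_zero, neg_zero, ih] at h
    have h1 := cast_succ_choose_succ_mul (R := ZMod (p ^ 2)) (m + k) (2 * k + 1)
    have h2 := cast_choose_succ_mul (R := ZMod (p ^ 2)) (m + k) (2 * k)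
    have hsq := natCast_sq_eq_zero_zmod_sq p
    have hu : IsUnit (((2 * k + 1 : ℕ) : ZMod (p ^ 2)) * ((8 : ℕ) * ((k + 1 : ℕ) ^ 2))) := by
      have h2u := isUnit_natCast_zmod_sq_of_lt (a := 2) hp (by omega) (by omega)
      have h8u : IsUnit ((8 : ℕ) : ZMod (p ^ 2)) := by
        have := h2u.pow 3
        norm_num at this ⊢
        exact this
      exact (isUnit_natCast_zmod_sq_of_lt hp (by omega) (by omega)).mul
        (h8u.mul ((isUnit_natCast_zmod_sq_of_lt hp (by omega) (by omega)).pow 2))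
    apply hu.mul_left_cancel
    simp only [show ∀ n, n + (k + 1) = n + k + 1 by intro n; ring,
      show 2 * (k + 1) = 2 * k + 2 by ring] at *
    rw [show 2 * k + 1 + 1 = 2 * k + 2 by ring] at h1
    have hm' : (p : ZMod (p ^ 2)) = 2 * m + 1 := by exact_mod_cast congrArg (Nat.cast) hm
    rw [hm'] at hsq
    push_cast at h1 h2 ⊢
    rw [pow_succ (-1 : ZMod (p ^ 2)) k]
    generalize ((m + k).choose (2 * k) : ZMod (p ^ 2)) = a at *
    generalize ((m + k).choose (2 * k + 1) : ZMod (p ^ 2)) = b at *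
    generalize ((m + k + 1).choose (2 * k + 2) : ZMod (p ^ 2)) = a' at *
    linear_combination (2 * (k : ZMod (p ^ 2)) + 1) * h +
      (2 * (k : ZMod (p ^ 2)) + 1) * 4 * (k + 1) * (-1) ^ k * h1 +
      4 * (k + 1) * (-1) ^ k * (m + k + 1) * h2 + (k + 1) * (-1) ^ k * a * hsq

theorem choose_mul_choose_add (n k : ℕ) :
    n.choose k * (n + k).choose k = (n + k).choose (2 * k) * (2 * k).choose k := by
  rw [Nat.choose_mul (by omega), mul_comm]
  congr 2 <;> omega

/-- The alternating sum of Apéry polynomials modulo `p ^ 2`. -/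
theorem sum_neg_one_pow_mul_aperyPoly {p m : ℕ} (hp : p.Prime) (hm : p = 2 * m + 1)
    (w : ZMod (p ^ 2)) :
    ∑ n ∈ range p, (-1 : ZMod (p ^ 2)) ^ n * aperyPoly n w =
      ∑ k ∈ range (m + 1),
        ((m + k).choose (2 * k) : ZMod (p ^ 2)) * ((2 * k).choose k : ZMod (p ^ 2)) ^ 2 * (-w) ^ k := by
  have h1 : ∀ n ∈ range p, (-1 : ZMod (p ^ 2)) ^ n * aperyPoly n w = ∑ k ∈ range p,
      ((2 * k).choose k : ZMod (p ^ 2)) ^ 2 * w ^ k *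
        ((-1) ^ n * ((n + k).choose (2 * k) : ZMod (p ^ 2)) ^ 2) := by
    intro n hn
    rw [aperyPoly, mul_sum]
    have hsub : range (n + 1) ⊆ range p := by
      intro x; simp only [mem_range] at *; omega
    rw [← sum_subset hsub]
    · refine sum_congr rfl fun k _ => ?_
      have := congrArg (Nat.cast : ℕ → ZMod (p ^ 2)) (choose_mul_choose_add n k)
      push_cast at this
      rw [← mul_pow (n.choose k : ZMod (p ^ 2)), this]
      ring
    · intro k _ hk
      rw [Nat.choose_eq_zero_of_lt (show n + k < 2 * k by simp at hk; omega)]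
      simp
  rw [sum_congr rfl h1, sum_comm]
  simp only [← mul_sum]
  have hsub : range (m + 1) ⊆ range p := by
    intro x; simp only [mem_range] at *; omega
  rw [← sum_subset hsub]
  · refine sum_congr rfl fun k hk => ?_
    rw [sum_neg_one_pow_mul_choose_sq_zmod hp hm (by simp at hk; omega), neg_pow w]
    ring
  · intro k hk hk'
    simp only [mem_range] at hk hk'
    rw [natCast_sq_eq_zero_of_dvd (hp.dvd_choose hk (by omega) (by omega))]
    ring

open Polynomial in
/-- The polynomial `∑ k, C(n+k,2k) C(2k,k) X^k`, a shifted Legendre polynomial. -/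
noncomputable def delannoyPoly (R : Type*) [CommRing R] (n : ℕ) : R[X] :=
  ∑ k ∈ range (n + 1), C (((n + k).choose (2 * k) : R) * ((2 * k).choose k : R)) * X ^ k

open Polynomial in
/-- The polynomial `∑ k, C(n+k,2k) C(2k,k)² X^k`. -/
noncomputable def clausenPoly (R : Type*) [CommRing R] (n : ℕ) : R[X] :=
  ∑ k ∈ range (n + 1), C (((n + k).choose (2 * k) : R) * ((2 * k).choose k : R) ^ 2) * X ^ k

theorem coeff_delannoyPoly (R : Type*) [CommRing R] (n k : ℕ) :
    (delannoyPoly R n).coeff k = ((n + k).choose (2 * k) : R) * ((2 * k).choose k : R) := by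
  simp only [delannoyPoly, Polynomial.finsetSum_coeff, Polynomial.coeff_C_mul_X_pow]
  rw [sum_ite_eq]
  split_ifs with h
  · rfl
  · rw [Nat.choose_eq_zero_of_lt (show n + k < 2 * k by simp at h; omega)]
    simp

theorem coeff_clausenPoly (R : Type*) [CommRing R] (n k : ℕ) :
    (clausenPoly R n).coeff k =
      ((n + k).choose (2 * k) : R) * ((2 * k).choose k : R) ^ 2 := by
  simp only [clausenPoly, Polynomial.finsetSum_coeff, Polynomial.coeff_C_mul_X_pow]
  rw [sum_ite_eq]
  split_ifs with h
  · rfl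
  · rw [Nat.choose_eq_zero_of_lt (show n + k < 2 * k by simp at h; omega)]
    simp

theorem choose_add_two_mul_succ (R : Type*) [CommRing R] (n k : ℕ) :
    ((n + (k + 1)).choose (2 * (k + 1)) : R) * ((2 * k + 1) * (2 * k + 2)) =
      (n + k).choose (2 * k) * ((n - k) * (n + k + 1)) := by
  have h1 := cast_succ_choose_succ_mul (R := R) (n + k) (2 * k + 1)
  have h2 := cast_choose_succ_mul (R := R) (n + k) (2 * k)
  rw [show n + (k + 1) = n + k + 1 by ring, show 2 * (k + 1) = 2 * k + 1 + 1 by ring]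
  push_cast at *
  linear_combination (2 * (k : R) + 1) * h1 + (n + k + 1) * h2

theorem centralBinom_succ_mul (k : ℕ) :
    ((2 * (k + 1)).choose (k + 1) : ℚ) * (k + 1) = 2 * (2 * k + 1) * (2 * k).choose k := by
  have h := congrArg (Nat.cast : ℕ → ℚ) (Nat.succ_mul_centralBinom_succ k)
  simp only [Nat.centralBinom] at h
  push_cast at h
  linear_combination h

theorem coeff_delannoyPoly_succ (n k : ℕ) :
    (delannoyPoly ℚ n).coeff (k + 1) * (k + 1) ^ 2 =
      (delannoyPoly ℚ n).coeff k * (n * (n + 1) - k * (k + 1)) := by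
  rw [coeff_delannoyPoly, coeff_delannoyPoly]
  have h1 := choose_add_two_mul_succ ℚ n k
  have h2 := centralBinom_succ_mul k
  generalize ((n + (k + 1)).choose (2 * (k + 1)) : ℚ) = a' at *
  generalize ((2 * (k + 1)).choose (k + 1) : ℚ) = b' at *
  have h0 : (2 * (2 * (k : ℚ) + 1)) ≠ 0 := by positivity
  apply mul_left_cancel₀ h0
  linear_combination 2 * (2 * (k : ℚ) + 1) * (k + 1) * a' * h2 +
    2 * (2 * k + 1) * (2 * k).choose k * h1

theorem coeff_clausenPoly_succ (n k : ℕ) :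
    (clausenPoly ℚ n).coeff (k + 1) * (k + 1) ^ 3 =
      (clausenPoly ℚ n).coeff k * (2 * (2 * k + 1) * (n * (n + 1) - k * (k + 1))) := by
  have h := coeff_delannoyPoly_succ n k
  rw [coeff_delannoyPoly, coeff_delannoyPoly] at h
  rw [coeff_clausenPoly, coeff_clausenPoly]
  have h2 := centralBinom_succ_mul k
  generalize ((2 * (k + 1)).choose (k + 1) : ℚ) = b' at *
  linear_combination b' * (k + 1) * h +
    ((n + k).choose (2 * k)) * (2 * k).choose k * (n * (n + 1) - k * (k + 1)) * h2

open Polynomial in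
theorem delannoyPoly_ode (n : ℕ) :
    (X ^ 2 + X) * derivative (derivative (delannoyPoly ℚ n)) +
      (2 * X + 1) * derivative (delannoyPoly ℚ n) =
    C ((n : ℚ) * (n + 1)) * delannoyPoly ℚ n := by
  ext k
  have h := coeff_delannoyPoly_succ n k
  rw [show (X ^ 2 + X) * derivative (derivative (delannoyPoly ℚ n)) +
      (2 * X + 1) * derivative (delannoyPoly ℚ n) =
      X ^ 2 * derivative (derivative (delannoyPoly ℚ n)) +
      X ^ 1 * derivative (derivative (delannoyPoly ℚ n)) +
      C 2 * (X ^ 1 * derivative (delannoyPoly ℚ n)) + derivative (delannoyPoly ℚ n) by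
        rw [map_ofNat]; ring]
  simp only [coeff_add, coeff_C_mul, coeff_X_pow_mul', coeff_derivative]
  match k with
  | 0 => simp at *; linear_combination h
  | 1 => simp at *; linear_combination h
  | k + 2 => simp at *; ring_nf at *; linear_combination h

open Polynomial in
theorem clausenPoly_ode (n : ℕ) :
    X ^ 2 * (1 + 4 * X) * derivative (derivative (derivative (clausenPoly ℚ n))) +
      (3 * X + 18 * X ^ 2) * derivative (derivative (clausenPoly ℚ n)) +
      (1 + 12 * X - 4 * C ((n : ℚ) * (n + 1)) * X) * derivative (clausenPoly ℚ n) =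
    2 * C ((n : ℚ) * (n + 1)) * clausenPoly ℚ n := by
  ext k
  have h := coeff_clausenPoly_succ n k
  generalize clausenPoly ℚ n = F at *
  rw [show X ^ 2 * (1 + 4 * X) * derivative (derivative (derivative F)) +
      (3 * X + 18 * X ^ 2) * derivative (derivative F) +
      (1 + 12 * X - 4 * C ((n : ℚ) * (n + 1)) * X) * derivative F =
      X ^ 2 * derivative (derivative (derivative F)) +
      C 4 * (X ^ 3 * derivative (derivative (derivative F))) +
      C 3 * (X ^ 1 * derivative (derivative F)) + C 18 * (X ^ 2 * derivative (derivative F)) +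
      derivative F + C (12 - 4 * ((n : ℚ) * (n + 1))) * (X ^ 1 * derivative F) by
        simp only [C_sub, C_mul, map_ofNat]; ring,
    show 2 * C ((n : ℚ) * (n + 1)) * F = C (2 * ((n : ℚ) * (n + 1))) * F by
      simp only [C_mul, map_ofNat]]
  simp only [coeff_add, coeff_C_mul, coeff_X_pow_mul', coeff_derivative]
  match k with
  | 0 => simp at *; linear_combination h
  | 1 => simp at *; linear_combination h
  | 2 => simp at *; ring_nf at *; linear_combination h
  | k + 3 => simp at *; ring_nf at *; linear_combination h

open Polynomial in
/-- A polynomial solution, vanishing at `0`, of the differential equation satisfied by the squares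
of Legendre polynomials is zero. -/
theorem eq_zero_of_symm_square_ode (N : ℚ) (w : ℚ[X]) (h0 : w.coeff 0 = 0)
    (h : (X ^ 2 + X) ^ 2 * derivative (derivative (derivative w)) +
      3 * (X ^ 2 + X) * (2 * X + 1) * derivative (derivative w) +
      (1 + (6 - 4 * C N) * (X ^ 2 + X)) * derivative w - 2 * C N * (2 * X + 1) * w = 0) :
    w = 0 := by
  have hz : ∀ d, ∀ i ≤ d, w.coeff i = 0 := by
    intro d
    induction d with
    | zero => intro i hi; rwa [Nat.le_zero.1 hi]
    | succ d ih =>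
      intro i hi
      rcases Nat.lt_or_ge i (d + 1) with hlt | hge
      · exact ih i (by omega)
      obtain rfl : i = d + 1 := by omega
      have hc := congrArg (fun q => q.coeff d) h
      rw [show (X ^ 2 + X) ^ 2 * derivative (derivative (derivative w)) +
        3 * (X ^ 2 + X) * (2 * X + 1) * derivative (derivative w) +
        (1 + (6 - 4 * C N) * (X ^ 2 + X)) * derivative w - 2 * C N * (2 * X + 1) * w =
        X ^ 4 * derivative (derivative (derivative w)) +
        C 2 * (X ^ 3 * derivative (derivative (derivative w))) +
        X ^ 2 * derivative (derivative (derivative w)) +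
        C 6 * (X ^ 3 * derivative (derivative w)) + C 9 * (X ^ 2 * derivative (derivative w)) +
        C 3 * (X ^ 1 * derivative (derivative w)) + derivative w +
        C (6 - 4 * N) * (X ^ 2 * derivative w) + C (6 - 4 * N) * (X ^ 1 * derivative w) -
        C (4 * N) * (X ^ 1 * w) - C (2 * N) * w by
          simp only [C_sub, C_mul, map_ofNat]; ring] at hc
      simp only [coeff_add, coeff_sub, coeff_C_mul, coeff_X_pow_mul', coeff_derivative,
        coeff_zero] at hc
      have hne : ((d : ℚ) + 1) ^ 3 ≠ 0 := by positivity
      refine (mul_eq_zero.1 (?_ : ((d : ℚ) + 1) ^ 3 * w.coeff (d + 1) = 0)).resolve_left hne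
      match d with
      | 0 =>
        simp [ih 0, -mul_eq_zero] at hc
        push_cast
        linear_combination hc
      | 1 =>
        simp [ih 0, ih 1, -mul_eq_zero] at hc
        push_cast
        linear_combination hc
      | 2 =>
        simp [ih 1, ih 2, -mul_eq_zero] at hc
        push_cast
        linear_combination hc
      | 3 =>
        simp [ih 2, ih 3, -mul_eq_zero] at hc
        push_cast
        linear_combination hc
      | d + 4 =>
        simp [ih (d + 4), ih (d + 3), -mul_eq_zero] at hc
        push_cast
        linear_combination hc
  ext i
  simpa using hz i i le_rfl

open Polynomial in
/-- A polynomial form of Clausen's identity over `ℚ`. -/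
theorem delannoyPoly_rat_sq (n : ℕ) :
    delannoyPoly ℚ n ^ 2 = (clausenPoly ℚ n).comp (X ^ 2 + X) := by
  rw [← sub_eq_zero]
  apply eq_zero_of_symm_square_ode ((n : ℚ) * (n + 1))
  · rw [coeff_zero_eq_eval_zero]
    simp only [eval_sub, eval_pow, eval_comp, eval_add, eval_X]
    norm_num
    rw [← coeff_zero_eq_eval_zero, ← coeff_zero_eq_eval_zero, coeff_delannoyPoly,
      coeff_clausenPoly]
    simp
  · have h1 := delannoyPoly_ode n
    have h2 := congrArg (fun q => q.comp (X ^ 2 + X)) (clausenPoly_ode n)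
    have h1' := congrArg derivative h1
    generalize delannoyPoly ℚ n = D at *
    generalize clausenPoly ℚ n = F at *
    generalize (n : ℚ) * (n + 1) = N at *
    simp only [mul_comp, add_comp, sub_comp, pow_comp, X_comp, C_comp, one_comp,
      ofNat_comp] at h2
    simp only [derivative_add, derivative_mul, derivative_C, derivative_X, derivative_sub,
      derivative_comp, derivative_pow, derivative_ofNat, derivative_one,
      derivative_zero, map_ofNat, Nat.cast_ofNat, Nat.add_one_sub_one, pow_one] at h1' ⊢
    generalize derivative (derivative (derivative D)) = D3 at *
    generalize derivative (derivative D) = D2 at *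
    generalize derivative D = D1 at *
    generalize (derivative (derivative (derivative F))).comp (X ^ 2 + X) = F3 at *
    generalize (derivative (derivative F)).comp (X ^ 2 + X) = F2 at *
    generalize (derivative F).comp (X ^ 2 + X) = F1 at *
    generalize F.comp (X ^ 2 + X) = F0 at *
    linear_combination 2 * (X ^ 2 + X) * D * h1' + (6 * (X ^ 2 + X) * D1 + 2 * (2 * X + 1) * D) * h1 -
      (2 * X + 1) * h2

theorem map_delannoyPoly {R S : Type*} [CommRing R] [CommRing S] (f : R →+* S) (n : ℕ) :
    (delannoyPoly R n).map f = delannoyPoly S n := by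
  ext k
  simp [coeff_delannoyPoly]

theorem map_clausenPoly {R S : Type*} [CommRing R] [CommRing S] (f : R →+* S) (n : ℕ) :
    (clausenPoly R n).map f = clausenPoly S n := by
  ext k
  simp [coeff_clausenPoly]

open Polynomial in
/-- A polynomial form of Clausen's identity over an arbitrary commutative ring. -/
theorem delannoyPoly_sq (R : Type*) [CommRing R] (n : ℕ) :
    delannoyPoly R n ^ 2 = (clausenPoly R n).comp (X ^ 2 + X) := by
  have h : delannoyPoly ℤ n ^ 2 = (clausenPoly ℤ n).comp (X ^ 2 + X) := by
    apply Polynomial.map_injective (Int.castRingHom ℚ) Int.cast_injective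
    simpa [Polynomial.map_comp, map_delannoyPoly, map_clausenPoly] using delannoyPoly_rat_sq n
  have h' := congrArg (Polynomial.map (Int.castRingHom R)) h
  simpa [Polynomial.map_comp, map_delannoyPoly, map_clausenPoly] using h'

theorem choose_mul_centralBinom_mul_factorial_sq (n k : ℕ) :
    (n + k).choose (2 * k) * (2 * k).choose k * k.factorial ^ 2 =
      (n + k).descFactorial (2 * k) := by
  have h := Nat.choose_mul_factorial_mul_factorial (show k ≤ 2 * k by omega)
  rw [show 2 * k - k = k by omega] at h
  rw [Nat.descFactorial_eq_factorial_mul_choose, ← h]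
  ring

theorem cast_descFactorial_succ {R : Type*} [CommRing R] (n k : ℕ) :
    (n.descFactorial (k + 1) : R) = (n - k) * n.descFactorial k := by
  rw [Nat.descFactorial_succ]
  rcases le_or_gt k n with hk | hk
  · push_cast [hk]
    ring
  · simp [Nat.descFactorial_of_lt hk]

open Polynomial in
/-- The three-term recurrence of the shifted Legendre polynomials. -/
theorem delannoyPoly_rat_recurrence (n : ℕ) :
    ((n : ℚ[X]) + 2) * delannoyPoly ℚ (n + 2) + ((n : ℚ[X]) + 1) * delannoyPoly ℚ n =
      (2 * (n : ℚ[X]) + 3) * (1 + 2 * X) * delannoyPoly ℚ (n + 1) := by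
  ext k
  rw [show ((n : ℚ[X]) + 2) * delannoyPoly ℚ (n + 2) + ((n : ℚ[X]) + 1) * delannoyPoly ℚ n =
    C ((n : ℚ) + 2) * delannoyPoly ℚ (n + 2) + C ((n : ℚ) + 1) * delannoyPoly ℚ n by
        simp only [C_add, map_ofNat, map_natCast, C_1],
    show (2 * (n : ℚ[X]) + 3) * (1 + 2 * X) * delannoyPoly ℚ (n + 1) =
      C (2 * (n : ℚ) + 3) * delannoyPoly ℚ (n + 1) +
      C (2 * (2 * (n : ℚ) + 3)) * (X ^ 1 * delannoyPoly ℚ (n + 1)) by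
        simp only [C_add, C_mul, map_ofNat, map_natCast]; ring]
  simp only [coeff_add, coeff_C_mul, coeff_X_pow_mul', coeff_delannoyPoly]
  match k with
  | 0 => simp; ring
  | k + 1 =>
    have e (m j : ℕ) := congrArg (Nat.cast : ℕ → ℚ) (choose_mul_centralBinom_mul_factorial_sq m j)
    have e1 := e (n + 2) (k + 1)
    have e2 := e (n + 1) (k + 1)
    have e3 := e n (k + 1)
    have e4 := e (n + 1) k
    rw [show n + 2 + (k + 1) = n + 1 + k + 1 + 1 by ring, show 2 * (k + 1) = 2 * k + 1 + 1 by ring,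
      Nat.succ_descFactorial_succ, Nat.succ_descFactorial_succ] at e1
    rw [show n + 1 + (k + 1) = n + 1 + k + 1 by ring, show 2 * (k + 1) = 2 * k + 1 + 1 by ring,
      Nat.succ_descFactorial_succ, Nat.cast_mul (n + 1 + k + 1), cast_descFactorial_succ] at e2
    rw [show n + (k + 1) = n + 1 + k by ring, show 2 * (k + 1) = 2 * k + 1 + 1 by ring,
      cast_descFactorial_succ, cast_descFactorial_succ] at e3
    rw [show n + 2 + (k + 1) = n + 1 + k + 1 + 1 by ring,
      show n + 1 + (k + 1) = n + 1 + k + 1 by ring, show n + (k + 1) = n + 1 + k by ring,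
      show 2 * (k + 1) = 2 * k + 1 + 1 by ring]
    simp only [Nat.factorial_succ, add_tsub_cancel_right, le_add_iff_nonneg_left, zero_le,
      if_true] at *
    push_cast at *
    have hk : ((k : ℚ) + 1) ^ 2 * (k.factorial : ℚ) ^ 2 ≠ 0 := by positivity
    apply mul_left_cancel₀ hk
    generalize ((n + 1 + k).descFactorial (2 * k) : ℚ) = V at *
    linear_combination ((n : ℚ) + 2) * e1 + ((n : ℚ) + 1) * e3 - (2 * (n : ℚ) + 3) * e2 -
      2 * (2 * (n : ℚ) + 3) * ((k : ℚ) + 1) ^ 2 * e4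

open Polynomial in
theorem delannoyPoly_recurrence (R : Type*) [CommRing R] (n : ℕ) :
    ((n : R[X]) + 2) * delannoyPoly R (n + 2) + ((n : R[X]) + 1) * delannoyPoly R n =
      (2 * (n : R[X]) + 3) * (1 + 2 * X) * delannoyPoly R (n + 1) := by
  have h : ((n : ℤ[X]) + 2) * delannoyPoly ℤ (n + 2) + ((n : ℤ[X]) + 1) * delannoyPoly ℤ n =
      (2 * (n : ℤ[X]) + 3) * (1 + 2 * X) * delannoyPoly ℤ (n + 1) := by
    apply Polynomial.map_injective (Int.castRingHom ℚ) Int.cast_injective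
    simpa [map_delannoyPoly] using delannoyPoly_rat_recurrence n
  have h' := congrArg (Polynomial.map (Int.castRingHom R)) h
  simpa [map_delannoyPoly] using h'

theorem eval_delannoyPoly {R : Type*} [CommRing R] (n : ℕ) (y : R) :
    (delannoyPoly R n).eval y =
      ∑ k ∈ range (n + 1), ((n + k).choose (2 * k) : R) * ((2 * k).choose k : R) * y ^ k := by
  simp [delannoyPoly, Polynomial.eval_finsetSum]

theorem factorial_mul_choose_add_choose (m k : ℕ) :
    ((4 * k + 1).factorial : ℚ) *
        (((m + 2 * k + 1).choose (4 * k + 1) : ℚ) + (m + 2 * k).choose (4 * k + 1)) =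
      (2 * m + 1) * (m + 2 * k).descFactorial (4 * k) := by
  have h1 := congrArg (Nat.cast : ℕ → ℚ)
    (Nat.descFactorial_eq_factorial_mul_choose (m + 2 * k + 1) (4 * k + 1))
  have h2 := congrArg (Nat.cast : ℕ → ℚ)
    (Nat.descFactorial_eq_factorial_mul_choose (m + 2 * k) (4 * k + 1))
  rw [Nat.succ_descFactorial_succ] at h1
  rw [cast_descFactorial_succ] at h2
  push_cast at *
  linear_combination -h1 - h2

/-- The sum of the coefficients obtained from the substitution `t / (1 - t ^ 2)` in the
lemniscatic integral. -/
def lemniscaticSum (m : ℕ) : ℕ :=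
  ∑ k ∈ range (m + 1), (2 * k).choose k * 4 ^ k *
    ((m + 2 * k + 1).choose (4 * k + 1) + (m + 2 * k).choose (4 * k + 1))

theorem lemniscaticSum_cast (m K : ℕ) (hK : m < K) :
    (lemniscaticSum m : ℚ) = ∑ k ∈ range K, ((2 * k).choose k : ℚ) * 4 ^ k /
      (4 * k + 1).factorial * ((2 * m + 1) * (m + 2 * k).descFactorial (4 * k)) := by
  have hsub : range (m + 1) ⊆ range K := by
    intro x; simp only [mem_range]; omega
  rw [lemniscaticSum, ← sum_subset hsub]
  · push_cast
    refine sum_congr rfl fun k _ => ?_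
    rw [← factorial_mul_choose_add_choose]
    have : ((4 * k + 1).factorial : ℚ) ≠ 0 := by positivity
    field_simp
  · intro k _ hk
    rw [Nat.descFactorial_of_lt (show m + 2 * k < 4 * k by simp at hk; omega)]
    simp

theorem sum_lemniscatic_recurrence (m j : ℕ) :
    ∑ k ∈ range (j + 1), ((2 * k).choose k : ℚ) * 4 ^ k / (4 * k + 1).factorial *
      ((m + 2) * ((2 * m + 5) * (m + 2 + 2 * k).descFactorial (4 * k)) -
        3 * (2 * m + 3) * ((2 * m + 3) * (m + 1 + 2 * k).descFactorial (4 * k)) +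
        (m + 1) * ((2 * m + 1) * (m + 2 * k).descFactorial (4 * k))) =
    -8 * (((2 * j).choose j : ℚ) * 4 ^ j / (4 * j + 1).factorial) *
      (m + 2 * j + 2).descFactorial (4 * j + 2) := by
  induction j with
  | zero => simp; ring
  | succ j ih =>
    rw [sum_range_succ, ih]
    have hf : ((2 * (j + 1)).choose (j + 1) : ℚ) * 4 ^ (j + 1) / (4 * (j + 1) + 1).factorial *
        (((j : ℚ) + 1) ^ 2 * (4 * j + 3) * (4 * j + 5)) =
        ((2 * j).choose j : ℚ) * 4 ^ j / (4 * j + 1).factorial := by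
      have h2 := centralBinom_succ_mul j
      rw [show 4 * (j + 1) + 1 = 4 * j + 1 + 1 + 1 + 1 + 1 by ring]
      simp only [Nat.factorial_succ (4 * j + 1 + 1 + 1 + 1), Nat.factorial_succ (4 * j + 1 + 1 + 1),
        Nat.factorial_succ (4 * j + 1 + 1), Nat.factorial_succ (4 * j + 1)]
      have h0 : ((4 * j + 1).factorial : ℚ) ≠ 0 := by positivity
      push_cast
      generalize ((4 * j + 1).factorial : ℚ) = F at *
      generalize ((2 * (j + 1)).choose (j + 1) : ℚ) = b at *
      have hb : b = 2 * (2 * j + 1) * (2 * j).choose j / (j + 1) := by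
        field_simp
        linear_combination h2
      rw [hb]
      field_simp
      ring
    rw [← hf]
    rw [show m + 2 + 2 * (j + 1) = m + 2 * j + 2 + 1 + 1 by ring,
      show m + 1 + 2 * (j + 1) = m + 2 * j + 2 + 1 by ring,
      show m + 2 * (j + 1) + 2 = m + 2 * j + 2 + 1 + 1 by ring,
      show m + 2 * (j + 1) = m + 2 * j + 2 by ring,
      show 4 * (j + 1) + 2 = 4 * j + 2 + 1 + 1 + 1 + 1 by ring,
      show 4 * (j + 1) = 4 * j + 2 + 1 + 1 by ring]
    simp only [Nat.succ_descFactorial_succ, Nat.cast_mul, cast_descFactorial_succ]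
    push_cast
    generalize ((m + 2 * j + 2).descFactorial (4 * j + 2) : ℚ) = V at *
    ring

theorem lemniscaticSum_recurrence (m : ℕ) :
    ((m : ℚ) + 2) * lemniscaticSum (m + 2) + (m + 1) * lemniscaticSum m =
      3 * (2 * m + 3) * lemniscaticSum (m + 1) := by
  have h := sum_lemniscatic_recurrence m (m + 2)
  rw [Nat.descFactorial_of_lt (show m + 2 * (m + 2) + 2 < 4 * (m + 2) + 2 by omega)] at h
  rw [lemniscaticSum_cast m (m + 2 + 1) (by omega), lemniscaticSum_cast (m + 1) (m + 2 + 1) (by omega),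
    lemniscaticSum_cast (m + 2) (m + 2 + 1) (by omega), ← sub_eq_zero, mul_sum, mul_sum, mul_sum,
    ← sum_add_distrib, ← sum_sub_distrib]
  rw [Nat.cast_zero, mul_zero] at h
  rw [← h]
  refine sum_congr rfl fun k _ => ?_
  push_cast
  ring

/-- The central Delannoy number, expanded along the quadratic transformation. -/
theorem sum_choose_mul_centralBinom_eq_lemniscaticSum (m : ℕ) :
    ∑ k ∈ range (m + 1), (m + k).choose (2 * k) * (2 * k).choose k = lemniscaticSum m := by
  have hrec (n : ℕ) := congrArg (Polynomial.eval 1) (delannoyPoly_recurrence ℚ n)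
  have key : ∀ m, (delannoyPoly ℚ m).eval 1 = lemniscaticSum m ∧
      (delannoyPoly ℚ (m + 1)).eval 1 = lemniscaticSum (m + 1) := by
    intro m
    induction m with
    | zero =>
      simp only [eval_delannoyPoly]
      norm_num [lemniscaticSum, sum_range_succ, Nat.choose]
    | succ m ih =>
      refine ⟨ih.2, ?_⟩
      have h1 := hrec m
      have h2 := lemniscaticSum_recurrence m
      simp only [Polynomial.eval_add, Polynomial.eval_mul, Polynomial.eval_natCast,
        Polynomial.eval_ofNat, Polynomial.eval_one, Polynomial.eval_X, ih.1, ih.2] at h1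
      have h0 : (m : ℚ) + 2 ≠ 0 := by positivity
      apply mul_left_cancel₀ h0
      linear_combination h1 - h2
  have h := (key m).1
  rw [eval_delannoyPoly] at h
  simp only [one_pow, mul_one] at h
  exact_mod_cast h

theorem eval_one_delannoyPoly (R : Type*) [CommRing R] (m : ℕ) :
    (delannoyPoly R m).eval 1 = lemniscaticSum m := by
  rw [eval_delannoyPoly, ← sum_choose_mul_centralBinom_eq_lemniscaticSum]
  simp

theorem eval_delannoyPoly_of_two_mul_eq_neg_one {R : Type*} [CommRing R] {y : R}
    (hy : 2 * y = -1) (n : ℕ) :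
    ((n : R) + 2) * (delannoyPoly R (n + 2)).eval y =
      -((n : R) + 1) * (delannoyPoly R n).eval y := by
  have h := congrArg (Polynomial.eval y) (delannoyPoly_recurrence R n)
  simp only [Polynomial.eval_add, Polynomial.eval_mul, Polynomial.eval_natCast,
    Polynomial.eval_ofNat, Polynomial.eval_one, Polynomial.eval_X] at h
  rw [hy] at h
  linear_combination h

/-- Partial fractions of the product `∏ (4i-1) / ∏ (4i+1)`, telescoped. -/
theorem sum_neg_one_pow_choose_recurrence (n j : ℕ) :
    ∑ k ∈ range (j + 1), (-1) ^ k * ((4 * (n : ℚ) + 5) *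
        (((n + 1 + k).choose (2 * k) : ℚ) * (2 * k).choose k) -
      (4 * n + 3) * (((n + k).choose (2 * k) : ℚ) * (2 * k).choose k)) / (4 * k + 1) =
    2 / (n + 1) * ((-1) ^ j * (n + 1 + j).descFactorial (2 * j + 1) / (j.factorial : ℚ) ^ 2) := by
  induction j with
  | zero => simp; field_simp; ring
  | succ j ih =>
    rw [sum_range_succ, ih]
    have e (m k : ℕ) : ((m + k).choose (2 * k) : ℚ) * (2 * k).choose k =
        (m + k).descFactorial (2 * k) / (k.factorial : ℚ) ^ 2 := by
      rw [eq_div_iff (by positivity)]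
      exact_mod_cast choose_mul_centralBinom_mul_factorial_sq m k
    rw [e, e, show n + 1 + (j + 1) = n + 1 + j + 1 by ring, show n + (j + 1) = n + 1 + j by ring,
      show 2 * (j + 1) + 1 = 2 * j + 1 + 1 + 1 by ring, show 2 * (j + 1) = 2 * j + 1 + 1 by ring]
    simp only [Nat.succ_descFactorial_succ (n + 1 + j), Nat.factorial_succ, Nat.cast_mul,
      cast_descFactorial_succ (n + 1 + j) (2 * j + 1)]
    have h0 : (j.factorial : ℚ) ≠ 0 := by positivity
    push_cast
    generalize ((n + 1 + j).descFactorial (2 * j + 1) : ℚ) = V at *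
    generalize (j.factorial : ℚ) = F at *
    rw [pow_succ]
    field_simp
    ring

/-- Partial fractions of `∏ (4i-1) / ∏ (4i+1)`. -/
theorem sum_neg_one_pow_choose_div (n : ℕ) :
    ∑ k ∈ range (n + 1), (-1) ^ k *
      (((n + k).choose (2 * k) : ℚ) * (2 * k).choose k) / (4 * k + 1) =
    (∏ i ∈ range n, (4 * (i : ℚ) + 3)) / ∏ i ∈ range (n + 1), (4 * (i : ℚ) + 1) := by
  induction n with
  | zero => simp
  | succ n ih =>
    have h := sum_neg_one_pow_choose_recurrence n (n + 1)
    rw [Nat.descFactorial_of_lt (show n + 1 + (n + 1) < 2 * (n + 1) + 1 by omega)] at h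
    have ih' : ∑ k ∈ range (n + 1 + 1), (-1) ^ k *
      (((n + k).choose (2 * k) : ℚ) * (2 * k).choose k) / (4 * k + 1) =
        (∏ i ∈ range n, (4 * (i : ℚ) + 3)) / ∏ i ∈ range (n + 1), (4 * (i : ℚ) + 1) := by
      rw [sum_range_succ, ih, Nat.choose_eq_zero_of_lt (show n + (n + 1) < 2 * (n + 1) by omega)]
      simp
    have h5 : 4 * (n : ℚ) + 5 ≠ 0 := by positivity
    apply mul_left_cancel₀ h5
    have hlin : (4 * (n : ℚ) + 5) * ∑ k ∈ range (n + 1 + 1), (-1) ^ k *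
      (((n + 1 + k).choose (2 * k) : ℚ) * (2 * k).choose k) / (4 * k + 1) =
      (4 * n + 3) * ∑ k ∈ range (n + 1 + 1), (-1) ^ k *
      (((n + k).choose (2 * k) : ℚ) * (2 * k).choose k) / (4 * k + 1) := by
      rw [← sub_eq_zero, mul_sum, mul_sum, ← sum_sub_distrib]
      simp only [Nat.cast_zero, mul_zero, zero_div] at h
      rw [← h]
      refine sum_congr rfl fun k _ => ?_
      ring
    rw [hlin, ih', prod_range_succ (fun i : ℕ => 4 * (i : ℚ) + 3) n,
      prod_range_succ (fun i : ℕ => 4 * (i : ℚ) + 1) (n + 1)]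
    push_cast
    rw [show 4 * ((n : ℚ) + 1) + 1 = 4 * n + 5 by ring]
    have : (∏ i ∈ range (n + 1), (4 * (i : ℚ) + 1)) ≠ 0 :=
      prod_ne_zero_iff.2 fun i _ => by positivity
    field_simp

theorem aperyPoly_map {R S : Type*} [CommRing R] [CommRing S] (f : R →+* S) (n : ℕ) (x : R) :
    f (aperyPoly n x) = aperyPoly n (f x) := by
  simp [aperyPoly]

theorem sum_neg_one_pow_mul_aperyPoly_eq_sq {p m : ℕ} (hp : p.Prime) (hm : p = 2 * m + 1)
    {w y : ZMod (p ^ 2)} (hy : y ^ 2 + y = -w) :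
    ∑ n ∈ range p, (-1 : ZMod (p ^ 2)) ^ n * aperyPoly n w =
      (delannoyPoly (ZMod (p ^ 2)) m).eval y ^ 2 := by
  rw [sum_neg_one_pow_mul_aperyPoly hp hm, ← Polynomial.eval_pow, delannoyPoly_sq,
    Polynomial.eval_comp, ← hy]
  simp [clausenPoly, Polynomial.eval_finsetSum]

/-- Congruences modulo `p ^ 2` in the `p`-adic integers are equalities in `ZMod (p ^ 2)`. -/
theorem exists_eq_sq_mul_of_toZModPow_eq {p : ℕ} [Fact p.Prime] {a b : ℤ_[p]}
    (h : PadicInt.toZModPow 2 a = PadicInt.toZModPow 2 b) :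
    ∃ z : ℤ_[p], (a : ℚ_[p]) - b = (p : ℚ_[p]) ^ 2 * z := by
  have h1 : a - b ∈ RingHom.ker (PadicInt.toZModPow (p := p) 2) := by
    rw [RingHom.mem_ker, map_sub, h, sub_self]
  rw [PadicInt.ker_toZModPow, Ideal.mem_span_singleton] at h1
  obtain ⟨z, hz⟩ := h1
  refine ⟨z, ?_⟩
  rw [← PadicInt.coe_sub, hz]
  push_cast
  rfl

theorem exists_sum_aperyPoly_padicInt {p : ℕ} [Fact p.Prime] {m : ℕ} (hm : p = 2 * m + 1)
    {w : ℤ_[p]} {y : ZMod (p ^ 2)} (hy : y ^ 2 + y = -PadicInt.toZModPow 2 w) :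
    ∃ a : ℤ_[p], (a : ℚ_[p]) = ∑ k ∈ range p, (-1 : ℚ_[p]) ^ k * aperyPoly k (w : ℚ_[p]) ∧
      PadicInt.toZModPow 2 a = (delannoyPoly (ZMod (p ^ 2)) m).eval y ^ 2 := by
  refine ⟨∑ k ∈ range p, (-1) ^ k * aperyPoly k w, ?_, ?_⟩
  · change PadicInt.Coe.ringHom _ = _
    rw [map_sum]
    refine sum_congr rfl fun k _ => ?_
    rw [map_mul, aperyPoly_map, map_pow, map_neg, map_one]
    rfl
  · rw [← sum_neg_one_pow_mul_aperyPoly_eq_sq Fact.out hm hy, map_sum]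
    refine sum_congr rfl fun k _ => ?_
    rw [map_mul, aperyPoly_map, map_pow, map_neg, map_one]

theorem dvd_lemniscaticSum {p m : ℕ} (hp : p.Prime) (hm : p = 2 * m + 1) (hodd : Odd m) :
    p ∣ lemniscaticSum m := by
  refine Finset.dvd_sum fun k _ => Dvd.dvd.mul_left ?_ _
  rcases lt_or_ge (4 * k + 1) p with hk | hk
  · have h : (4 * k + 1) * ((m + 2 * k + 1).choose (4 * k + 1) + (m + 2 * k).choose (4 * k + 1)) =
        p * (m + 2 * k).choose (4 * k) := by
      have h1 := cast_choose_succ_mul (R := ℤ) (m + 2 * k) (4 * k)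
      have h2 := cast_succ_choose_succ_mul (R := ℤ) (m + 2 * k) (4 * k)
      zify [hm]
      push_cast at *
      linear_combination h1 + h2
    refine (Nat.Coprime.dvd_mul_left ?_).1 ⟨_, h⟩
    rw [hp.coprime_iff_not_dvd]
    exact fun h => absurd (Nat.le_of_dvd (by omega) h) (by omega)
  · have : 4 * k + 1 ≠ p := by
      obtain ⟨j, rfl⟩ := hodd
      omega
    rw [Nat.choose_eq_zero_of_lt (by omega), Nat.choose_eq_zero_of_lt (by omega)]
    exact dvd_zero _

theorem eval_delannoyPoly_odd {p : ℕ} (hp : p.Prime) {y : ZMod (p ^ 2)} (hy : 2 * y = -1)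
    {j : ℕ} (hj : 2 * j + 1 < p) : (delannoyPoly (ZMod (p ^ 2)) (2 * j + 1)).eval y = 0 := by
  induction j with
  | zero =>
    rw [eval_delannoyPoly]
    simp [sum_range_succ]
    linear_combination hy
  | succ j ih =>
    have h := eval_delannoyPoly_of_two_mul_eq_neg_one hy (2 * j + 1)
    rw [ih (by omega), mul_zero] at h
    have hu := isUnit_natCast_zmod_sq_of_lt (a := 2 * j + 1 + 2) hp (by omega) (by omega)
    push_cast at hu h
    exact hu.mul_left_cancel (by rw [mul_zero]; exact h)

theorem eval_delannoyPoly_even {p : ℕ} (hp : p.Prime) {y : ZMod (p ^ 2)} (hy : 2 * y = -1)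
    {j : ℕ} (hj : 2 * j < p) : 4 ^ j * (delannoyPoly (ZMod (p ^ 2)) (2 * j)).eval y =
      (-1 : ZMod (p ^ 2)) ^ j * ((2 * j).choose j : ZMod (p ^ 2)) := by
  induction j with
  | zero =>
    rw [eval_delannoyPoly]
    simp
  | succ j ih =>
    have h := eval_delannoyPoly_of_two_mul_eq_neg_one hy (2 * j)
    have ih := ih (by omega)
    have hu := (isUnit_natCast_zmod_sq_of_lt (a := 2 * j + 2) hp (by omega) (by omega))
    have h2 := congrArg (Nat.cast : ℕ → ZMod (p ^ 2)) (Nat.succ_mul_centralBinom_succ j)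
    simp only [Nat.centralBinom] at h2
    push_cast at hu h h2
    rw [show 2 * (j + 1) = 2 * j + 2 by ring] at *
    rw [pow_succ (4 : ZMod (p ^ 2)), pow_succ (-1 : ZMod (p ^ 2))]
    apply hu.mul_left_cancel
    linear_combination 4 * (4 : ZMod (p ^ 2)) ^ j * h - 4 * (2 * j + 1) * ih +
      2 * (-1 : ZMod (p ^ 2)) ^ j * h2

theorem sum_range_two_mul {M : Type*} [AddCommMonoid M] (f : ℕ → M) (n : ℕ) :
    ∑ i ∈ range (2 * n), f i = ∑ i ∈ range n, (f (2 * i) + f (2 * i + 1)) := by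
  induction n with
  | zero => simp
  | succ n ih =>
    rw [show 2 * (n + 1) = 2 * n + 1 + 1 by ring, sum_range_succ, sum_range_succ, sum_range_succ,
      ih, add_assoc]

/-- A first order expansion of a product. -/
theorem prod_add_mul_of_sq_eq_zero {ι R : Type*} [CommRing R] {ε : R} (hε : ε ^ 2 = 0)
    (s : Finset ι) {u v w : ι → R} (h : ∀ i ∈ s, u i * w i = 1) :
    ∏ i ∈ s, (u i + ε * v i) = (∏ i ∈ s, u i) * (1 + ε * ∑ i ∈ s, v i * w i) := by
  classical
  induction s using Finset.induction_on with
  | empty => simp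
  | insert a s ha ih =>
    rw [prod_insert ha, prod_insert ha, sum_insert ha, ih fun i hi => h i (mem_insert_of_mem hi)]
    have h1 := h a (mem_insert_self a s)
    linear_combination (-(∏ i ∈ s, u i) * ε * v a) * h1 +
      (∏ i ∈ s, u i) * v a * (∑ i ∈ s, v i * w i) * hε

theorem mul_inv_natCast_zmod_sq {p a : ℕ} (hp : p.Prime) (h0 : 0 < a) (ha : a < p) :
    (a : ZMod (p ^ 2)) * (a : ZMod (p ^ 2))⁻¹ = 1 :=
  ZMod.mul_inv_of_unit _ (isUnit_natCast_zmod_sq_of_lt hp h0 ha)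

theorem prime_mul_choose_pred {p : ℕ} (hp : p.Prime) {k : ℕ} (hk : k < p) :
    (p : ZMod (p ^ 2)) * ((p - 1).choose k : ZMod (p ^ 2)) =
      (p : ZMod (p ^ 2)) * (-1 : ZMod (p ^ 2)) ^ k := by
  induction k with
  | zero => simp
  | succ k ih =>
    have ih := ih (by omega)
    obtain ⟨c, hc⟩ := hp.dvd_choose_self (k := k + 1) (by omega) hk
    have h : (p - 1).choose k + (p - 1).choose (k + 1) = p * c := by
      rw [← hc, ← Nat.choose_succ_succ, Nat.succ_eq_add_one, Nat.sub_add_cancel hp.one_le]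
    have h := congrArg (Nat.cast : ℕ → ZMod (p ^ 2)) h
    push_cast at h
    rw [pow_succ (-1 : ZMod (p ^ 2))]
    linear_combination (p : ZMod (p ^ 2)) * h - ih + c * natCast_sq_eq_zero_zmod_sq p

theorem sum_neg_one_pow_mul_choose_two_mul (n : ℕ) :
    ∑ j ∈ range (2 * n + 1), (-1 : ℤ) ^ j * ((4 * n + 1).choose (2 * j) : ℤ) = (-4) ^ n := by
  have h1 : (1 + Complex.I) ^ (4 * n + 1) = (((-4 : ℝ) ^ n : ℝ) : ℂ) * (1 + Complex.I) := by
    have h4 : (1 + Complex.I) ^ 4 = -4 := by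
      linear_combination (Complex.I ^ 2 + 4 * Complex.I + 5) * Complex.I_sq
    rw [pow_succ, pow_mul, h4]
    push_cast
    rfl
  have h2 := congrArg Complex.re h1
  rw [Complex.re_ofReal_mul, add_comm 1 Complex.I, add_pow,
    show 4 * n + 1 + 1 = 2 * (2 * n + 1) by ring, sum_range_two_mul, Complex.re_sum] at h2
  have h3 : ∀ j ∈ range (2 * n + 1), (Complex.I ^ (2 * j) * 1 ^ (4 * n + 1 - 2 * j) *
      ((4 * n + 1).choose (2 * j) : ℂ) + Complex.I ^ (2 * j + 1) * 1 ^ (4 * n + 1 - (2 * j + 1)) *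
      ((4 * n + 1).choose (2 * j + 1) : ℂ)).re =
      (-1 : ℝ) ^ j * ((4 * n + 1).choose (2 * j) : ℝ) := by
    intro j _
    have e1 : Complex.I ^ (2 * j) = (((-1 : ℝ) ^ j : ℝ) : ℂ) := by
      rw [pow_mul, Complex.I_sq]; push_cast; rfl
    rw [pow_succ Complex.I, e1, one_pow, one_pow, Complex.add_re, mul_one, mul_one, mul_assoc,
      Complex.re_ofReal_mul, Complex.re_ofReal_mul]
    simp
  rw [sum_congr rfl h3] at h2
  simp only [Complex.add_re, Complex.I_re, Complex.one_re, zero_add, mul_one] at h2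
  exact_mod_cast h2

/-- The Fermat quotient term measuring `(-4) ^ ((p - 1) / 4)` modulo `p ^ 2`. -/
def fermatTerm (p n : ℕ) : ZMod (p ^ 2) :=
  p * ∑ i ∈ range (2 * n), (-1 : ZMod (p ^ 2)) ^ i * ((2 * (i + 1) : ℕ) : ZMod (p ^ 2))⁻¹

theorem mul_fermatTerm_self (p n : ℕ) : (p : ZMod (p ^ 2)) * fermatTerm p n = 0 := by
  rw [fermatTerm, ← mul_assoc, ← sq, natCast_sq_eq_zero_zmod_sq, zero_mul]

theorem fermatTerm_sq (p n : ℕ) : fermatTerm p n ^ 2 = 0 := by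
  rw [fermatTerm, mul_pow, natCast_sq_eq_zero_zmod_sq, zero_mul]

theorem neg_four_pow_eq {p n : ℕ} (hp : p.Prime) (hn : p = 4 * n + 1) :
    (-4 : ZMod (p ^ 2)) ^ n = 1 + fermatTerm p n := by
  have h := congrArg (Int.cast : ℤ → ZMod (p ^ 2)) (sum_neg_one_pow_mul_choose_two_mul n)
  push_cast at h
  rw [← h, sum_range_succ', fermatTerm, mul_sum, add_comm]
  congr 1
  · simp
  refine sum_congr rfl fun i hi => ?_
  simp only [mem_range] at hi
  apply (isUnit_natCast_zmod_sq_of_lt (a := 2 * (i + 1)) hp (by omega) (by omega)).mul_left_cancel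
  have h1 := mul_inv_natCast_zmod_sq (a := 2 * (i + 1)) hp (by omega) (by omega)
  have h2 := prime_mul_choose_pred hp (k := 2 * i + 1) (by omega)
  have h3 := congrArg (Nat.cast : ℕ → ZMod (p ^ 2)) (Nat.add_one_mul_choose_eq (4 * n) (2 * i + 1))
  rw [show p - 1 = 4 * n by omega, pow_succ (-1 : ZMod (p ^ 2)) (2 * i), pow_mul, neg_one_sq,
    one_pow] at h2
  have h4 : ((4 * n : ℕ) : ZMod (p ^ 2)) + 1 = p := by
    exact_mod_cast (congrArg (Nat.cast : ℕ → ZMod (p ^ 2)) hn).symm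
  rw [Nat.cast_mul, Nat.cast_succ, h4, h2] at h3
  rw [show 2 * (i + 1) = 2 * i + 1 + 1 by ring] at *
  rw [pow_succ (-1 : ZMod (p ^ 2)) i]
  push_cast at h1 h3 ⊢
  linear_combination (-1 : ZMod (p ^ 2)) ^ i * h3 - p * (-1 : ZMod (p ^ 2)) ^ i * h1

theorem factorial_mul_prod_four_mul_add_two (n : ℕ) :
    n.factorial * ∏ i ∈ range n, (4 * i + 2) = (2 * n).factorial := by
  induction n with
  | zero => simp
  | succ n ih =>
    rw [prod_range_succ, show 2 * (n + 1) = 2 * n + 1 + 1 by ring, Nat.factorial_succ,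
      Nat.factorial_succ, Nat.factorial_succ, ← ih]
    ring

theorem prod_four_mul_add_four (n : ℕ) :
    ∏ i ∈ range n, (4 * (i + 1)) = 4 ^ n * n.factorial := by
  rw [prod_mul_distrib, prod_const, card_range, ← prod_range_add_one_eq_factorial]

theorem four_pow_mul_prod_eq {p n : ℕ} (hp : p.Prime) (hn : p = 4 * n + 1) :
    (4 : ZMod (p ^ 2)) ^ n * ∏ i ∈ range n, (4 * (i : ZMod (p ^ 2)) + 3) =
      (∏ i ∈ range n, (4 * (i : ZMod (p ^ 2)) + 1)) * ((2 * n).choose n : ZMod (p ^ 2)) *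
        (1 - fermatTerm p n) := by
  have hpn : (p : ZMod (p ^ 2)) = 4 * n + 1 := by
    exact_mod_cast congrArg (Nat.cast : ℕ → ZMod (p ^ 2)) hn
  have hsq := natCast_sq_eq_zero_zmod_sq p
  have key (c : ℕ) (hc : c ≤ 4) (hc0 : 0 < c) :
      ∏ i ∈ range n, (4 * (i : ZMod (p ^ 2)) + (5 - c)) =
      (-1) ^ n * (((∏ i ∈ range n, (4 * i + c) : ℕ) : ZMod (p ^ 2)) *
        (1 - p * ∑ i ∈ range n, ((4 * i + c : ℕ) : ZMod (p ^ 2))⁻¹)) := by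
    have h := prod_add_mul_of_sq_eq_zero hsq (range n)
      (u := fun i => ((4 * i + c : ℕ) : ZMod (p ^ 2))) (v := fun _ => -1)
      (w := fun i => ((4 * i + c : ℕ) : ZMod (p ^ 2))⁻¹) (by
        intro i hi
        simp only [mem_range] at hi
        exact mul_inv_natCast_zmod_sq hp (by omega) (by omega))
    simp only [neg_mul, one_mul, sum_neg_distrib, mul_neg, mul_one, ← sub_eq_add_neg] at h
    rw [Nat.cast_prod, ← h, ← prod_range_reflect]
    rw [show (-1 : ZMod (p ^ 2)) ^ n = ∏ i ∈ range n, (-1 : ZMod (p ^ 2)) by simp,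
      ← prod_mul_distrib]
    refine prod_congr rfl fun i hi => ?_
    simp only [mem_range] at hi
    obtain ⟨j, rfl⟩ : ∃ j, n = i + 1 + j := ⟨n - (i + 1), by omega⟩
    rw [show i + 1 + j - 1 - i = j by omega, hpn]
    push_cast
    ring
  have h3 := key 2 (by omega) (by omega)
  have h1 := key 4 (by omega) (by omega)
  simp only [show ∀ i, 4 * i + 4 = 4 * (i + 1) by intro i; ring, prod_four_mul_add_four] at h1
  have hfac := congrArg (Nat.cast : ℕ → ZMod (p ^ 2)) (factorial_mul_prod_four_mul_add_two n)
  have hB := congrArg (Nat.cast : ℕ → ZMod (p ^ 2))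
    (Nat.choose_mul_factorial_mul_factorial (show n ≤ 2 * n by omega))
  rw [show 2 * n - n = n by omega] at hB
  have hg : fermatTerm p n = p * ∑ i ∈ range n, ((4 * i + 2 : ℕ) : ZMod (p ^ 2))⁻¹ -
      p * ∑ i ∈ range n, ((4 * (i + 1) : ℕ) : ZMod (p ^ 2))⁻¹ := by
    rw [fermatTerm, sum_range_two_mul, ← mul_sub, ← sum_sub_distrib]
    congr 1
    refine sum_congr rfl fun i _ => ?_
    rw [show 2 * (2 * i + 1) = 4 * i + 2 by ring, show 2 * (2 * i + 1 + 1) = 4 * (i + 1) by ring,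
      pow_succ (-1 : ZMod (p ^ 2)) (2 * i), pow_mul, neg_one_sq, one_pow]
    ring
  have hu : IsUnit (n.factorial : ZMod (p ^ 2)) := by
    refine isUnit_natCast_zmod_sq hp fun h => ?_
    have := (hp.dvd_factorial).1 h
    omega
  norm_num at h1 h3
  rw [h1, h3, hg]
  push_cast at hB hfac ⊢
  generalize ∑ i ∈ range n, ((4 * (i : ZMod (p ^ 2)) + 2))⁻¹ = S at *
  generalize ∑ i ∈ range n, ((4 * ((i : ZMod (p ^ 2)) + 1)))⁻¹ = T at *
  generalize ∏ i ∈ range n, (4 * (i : ZMod (p ^ 2)) + 2) = P at *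
  apply hu.mul_left_cancel
  linear_combination (4 : ZMod (p ^ 2)) ^ n * (-1) ^ n * (1 - p * S) * hfac -
    (4 : ZMod (p ^ 2)) ^ n * (-1) ^ n * (1 - p * T) * (1 - (p * S - p * T)) * hB -
    (4 : ZMod (p ^ 2)) ^ n * (-1) ^ n * (2 * n).factorial * T * (S - T) * hsq

theorem sum_neg_one_pow_choose_mul_prod (n : ℕ) :
    ∑ k ∈ range (n + 1), (-1 : ℤ) ^ k * (((n + k).choose (2 * k) : ℤ) * (2 * k).choose k) *
      ∏ i ∈ (range (n + 1)).erase k, (4 * (i : ℤ) + 1) = ∏ i ∈ range n, (4 * (i : ℤ) + 3) := by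
  have h := sum_neg_one_pow_choose_div n
  have h0 : (∏ i ∈ range (n + 1), (4 * (i : ℚ) + 1)) ≠ 0 :=
    prod_ne_zero_iff.2 fun i _ => by positivity
  rw [eq_div_iff h0, sum_mul] at h
  have : ∑ k ∈ range (n + 1), (-1 : ℚ) ^ k *
      (((n + k).choose (2 * k) : ℚ) * (2 * k).choose k) *
      ∏ i ∈ (range (n + 1)).erase k, (4 * (i : ℚ) + 1) = ∏ i ∈ range n, (4 * (i : ℚ) + 3) := by
    rw [← h]
    refine sum_congr rfl fun k hk => ?_
    rw [← mul_prod_erase _ _ hk]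
    have : 4 * (k : ℚ) + 1 ≠ 0 := by positivity
    field_simp
  exact_mod_cast this

theorem prime_mul_four_pow_mul_choose {p n : ℕ} (hp : p.Prime) (hn : p = 4 * n + 1) {k : ℕ}
    (hk : k ≤ n) :
    (p : ZMod (p ^ 2)) * (4 ^ k * ((2 * n + 2 * k).choose (4 * k) : ZMod (p ^ 2))) =
      p * ((-1) ^ k * ((n + k).choose (2 * k) : ZMod (p ^ 2))) := by
  induction k with
  | zero => simp
  | succ k ih =>
    have ih := ih (by omega)
    have hsq := natCast_sq_eq_zero_zmod_sq p
    have hpn : (p : ZMod (p ^ 2)) = 4 * n + 1 := by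
      exact_mod_cast congrArg (Nat.cast : ℕ → ZMod (p ^ 2)) hn
    have hu (a : ℕ) (h0 : 0 < a) (ha : a < p) := isUnit_natCast_zmod_sq_of_lt hp h0 ha
    have h1 := choose_add_two_mul_succ (ZMod (p ^ 2)) (2 * n) (2 * k)
    have h2 := choose_add_two_mul_succ (ZMod (p ^ 2)) (2 * n) (2 * k + 1)
    have h3 := choose_add_two_mul_succ (ZMod (p ^ 2)) n k
    rw [show 2 * (2 * k) = 4 * k by ring, show 2 * (2 * k + 1) = 4 * k + 2 by ring] at h1
    rw [show 2 * n + (2 * k + 1 + 1) = 2 * n + 2 * (k + 1) by ring,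
      show 2 * (2 * k + 1 + 1) = 4 * (k + 1) by ring,
      show 2 * (2 * k + 1) = 4 * k + 2 by ring] at h2
    apply (((hu (4 * k + 1) (by omega) (by omega)).mul (hu (4 * k + 2) (by omega) (by omega))).mul
      ((hu (4 * k + 3) (by omega) (by omega)).mul (hu (4 * k + 4) (by omega)
        (by omega)))).mul_left_cancel
    rw [pow_succ (4 : ZMod (p ^ 2)), pow_succ (-1 : ZMod (p ^ 2))]
    push_cast at h1 h2 h3 ⊢
    generalize ((2 * n + 2 * (k + 1)).choose (4 * (k + 1)) : ZMod (p ^ 2)) = a at *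
    generalize ((2 * n + (2 * k + 1)).choose (4 * k + 2) : ZMod (p ^ 2)) = b at *
    generalize ((2 * n + 2 * k).choose (4 * k) : ZMod (p ^ 2)) = c at *
    generalize ((n + (k + 1)).choose (2 * (k + 1)) : ZMod (p ^ 2)) = d at *
    generalize ((n + k).choose (2 * k) : ZMod (p ^ 2)) = f at *
    linear_combination (p * 4 ^ k * 4 * (4 * k + 1) * (4 * k + 2) : ZMod (p ^ 2)) * h2 +
      (p * 4 ^ k * 4 * ((2 * n - 2 * k - 1) * (2 * n + 2 * k + 2)) : ZMod (p ^ 2)) * h1 +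
      (4 * ((2 * n - 2 * k) * (2 * n + 2 * k + 1) * (2 * n - 2 * k - 1) * (2 * n + 2 * k + 2)) :
        ZMod (p ^ 2)) * ih -
      (16 * p * (-1) ^ k * ((2 * n + 2 * k + 1) * (2 * n - 2 * k - 1)) : ZMod (p ^ 2)) * h3 -
      4 * p * (-1) ^ k * d * ((2 * k + 1) * (2 * k + 2)) * (4 * n + p - 1) * hpn +
      4 * (p - 2) * (-1) ^ k * d * ((2 * k + 1) * (2 * k + 2)) * hsq

theorem lemniscaticSum_two_mul {p n : ℕ} (hp : p.Prime) (hn : p = 4 * n + 1) :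
    (lemniscaticSum (2 * n) : ZMod (p ^ 2)) =
      (-1) ^ n * ((2 * n).choose n : ZMod (p ^ 2)) * (1 - fermatTerm p n) := by
  have hpn : (p : ZMod (p ^ 2)) = 4 * n + 1 := by
    exact_mod_cast congrArg (Nat.cast : ℕ → ZMod (p ^ 2)) hn
  have hpf := congrArg (Int.cast : ℤ → ZMod (p ^ 2)) (sum_neg_one_pow_choose_mul_prod n)
  have hu : IsUnit (∏ i ∈ range n, (4 * (i : ZMod (p ^ 2)) + 1)) := by
    rw [IsUnit.prod_iff]
    intro i hi
    simp only [mem_range] at hi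
    exact_mod_cast isUnit_natCast_zmod_sq_of_lt (a := 4 * i + 1) hp (by omega) (by omega)
  have h4 := four_pow_mul_prod_eq hp hn
  have he := neg_four_pow_eq hp hn
  set Q := ∏ i ∈ range n, (4 * (i : ZMod (p ^ 2)) + 1) with hQ
  have hsum : Q * (lemniscaticSum (2 * n) : ZMod (p ^ 2)) = ∑ k ∈ range n,
      (-1 : ZMod (p ^ 2)) ^ k * (((n + k).choose (2 * k) : ZMod (p ^ 2)) * (2 * k).choose k) *
        ∏ i ∈ (range (n + 1)).erase k, (4 * (i : ZMod (p ^ 2)) + 1) +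
      Q * ((2 * n).choose n * 4 ^ n) := by
    have hsub : range (n + 1) ⊆ range (2 * n + 1) := by
      intro x; simp only [mem_range]; omega
    rw [lemniscaticSum, ← sum_subset hsub, sum_range_succ]
    · push_cast
      rw [mul_add, mul_sum]
      congr 1
      · refine sum_congr rfl fun k hk => ?_
        simp only [mem_range] at hk
        have hu1 := isUnit_natCast_zmod_sq_of_lt (a := 4 * k + 1) hp (by omega) (by omega)
        apply hu1.mul_left_cancel
        have e1 := cast_choose_succ_mul (R := ZMod (p ^ 2)) (2 * n + 2 * k) (4 * k)
        have e2 := cast_succ_choose_succ_mul (R := ZMod (p ^ 2)) (2 * n + 2 * k) (4 * k)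
        have e3 := prime_mul_four_pow_mul_choose hp hn hk.le
        have e4 : (4 * (k : ZMod (p ^ 2)) + 1) *
            ∏ i ∈ (range (n + 1)).erase k, (4 * (i : ZMod (p ^ 2)) + 1) = Q * p := by
          rw [mul_prod_erase (range (n + 1)) (fun i : ℕ => 4 * (i : ZMod (p ^ 2)) + 1)
            (by simp; omega), prod_range_succ, hpn]
        push_cast at e1 e2 e3 ⊢
        generalize ∏ i ∈ (range (n + 1)).erase k, (4 * (i : ZMod (p ^ 2)) + 1) = E at *
        linear_combination Q * (2 * k).choose k * 4 ^ k * (e1 + e2) +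
          Q * (2 * k).choose k * e3 -
          (-1 : ZMod (p ^ 2)) ^ k * (((n + k).choose (2 * k) : ZMod (p ^ 2)) * (2 * k).choose k) * e4 -
          Q * (2 * k).choose k * 4 ^ k * (2 * n + 2 * k).choose (4 * k) * hpn
      · rw [show 2 * n + 2 * n = 4 * n by ring, Nat.choose_self, Nat.choose_succ_self]
        simp
    · intro k _ hk
      simp only [mem_range] at hk
      rw [Nat.choose_eq_zero_of_lt (show 2 * n + 2 * k + 1 < 4 * k + 1 by omega),
        Nat.choose_eq_zero_of_lt (show 2 * n + 2 * k < 4 * k + 1 by omega), add_zero, mul_zero]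
  rw [sum_range_succ, range_add_one, erase_insert (by simp), ← range_add_one,
    show n + n = 2 * n by ring, Nat.choose_self] at hpf
  push_cast at hpf
  rw [← hQ] at hpf
  have h4u : IsUnit ((4 : ZMod (p ^ 2)) ^ n) := by
    refine IsUnit.pow _ ?_
    refine isUnit_natCast_zmod_sq (a := 4) hp fun h => ?_
    have := (hp.dvd_mul (m := 2) (n := 2)).1 h
    have := Nat.le_of_dvd (by norm_num) (this.elim id id)
    have : n ≠ 0 := by rintro rfl; exact hp.one_lt.ne' hn
    omega
  apply (h4u.mul hu).mul_left_cancel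
  have hg := fermatTerm_sq p n
  rw [neg_pow] at he
  have hs : (-1 : ZMod (p ^ 2)) ^ n * (-1) ^ n = 1 := by
    rw [← mul_pow]; simp
  generalize (-1 : ZMod (p ^ 2)) ^ n = s at *
  generalize (4 : ZMod (p ^ 2)) ^ n = f at *
  generalize fermatTerm p n = g at *
  generalize ((2 * n).choose n : ZMod (p ^ 2)) = B at *
  have hf : f = s * (1 + g) := by linear_combination s * he - f * hs
  subst hf
  linear_combination s * (1 + g) * hsum + s * (1 + g) * hpf + h4 +
    (g * Q * B - Q * B) * hs + 2 * s ^ 2 * Q * B * hg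

theorem lemniscaticSum_two_mul_sq {p n : ℕ} (hp : p.Prime) (hn : p = 4 * n + 1) :
    (lemniscaticSum (2 * n) : ZMod (p ^ 2)) ^ 2 =
      ((2 * n).choose n : ZMod (p ^ 2)) ^ 2 * (1 - 2 * fermatTerm p n) := by
  rw [lemniscaticSum_two_mul hp hn, mul_pow, mul_pow, ← pow_mul, mul_comm n 2, pow_mul,
    neg_one_sq, one_pow]
  linear_combination ((2 * n).choose n : ZMod (p ^ 2)) ^ 2 * fermatTerm_sq p n

theorem eval_delannoyPoly_sq_eq {p n : ℕ} (hp : p.Prime) (hn : p = 4 * n + 1) {y : ZMod (p ^ 2)}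
    (hy : 2 * y = -1) : (delannoyPoly (ZMod (p ^ 2)) (2 * n)).eval y ^ 2 =
      ((2 * n).choose n : ZMod (p ^ 2)) ^ 2 * (1 - 2 * fermatTerm p n) := by
  have h := eval_delannoyPoly_even hp hy (j := n) (by omega)
  have he := neg_four_pow_eq hp hn
  have hg := fermatTerm_sq p n
  rw [neg_pow] at he
  have hs : (-1 : ZMod (p ^ 2)) ^ n * (-1) ^ n = 1 := by
    rw [← mul_pow]; simp
  generalize (-1 : ZMod (p ^ 2)) ^ n = s at *
  generalize (4 : ZMod (p ^ 2)) ^ n = f at *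
  generalize fermatTerm p n = g at *
  generalize ((2 * n).choose n : ZMod (p ^ 2)) = B at *
  generalize (delannoyPoly (ZMod (p ^ 2)) (2 * n)).eval y = D at *
  have hD : (1 + g) * D = B := by linear_combination s * h - D * he + B * hs
  rw [← hD]
  linear_combination (D ^ 2 * (3 + 2 * g)) * hg

theorem sq_eq_zero_of_castHom_eq_zero {p : ℕ} [Fact p.Prime] {r : ZMod (p ^ 2)}
    (h : ZMod.castHom (dvd_pow_self p two_ne_zero) (ZMod p) r = 0) : r ^ 2 = 0 := by
  rw [← ZMod.natCast_zmod_val r] at h ⊢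
  rw [map_natCast, ZMod.natCast_eq_zero_iff] at h
  exact natCast_sq_eq_zero_of_dvd h

theorem isUnit_of_castHom_ne_zero {p : ℕ} [Fact p.Prime] {r : ZMod (p ^ 2)}
    (h : ZMod.castHom (dvd_pow_self p two_ne_zero) (ZMod p) r ≠ 0) : IsUnit r := by
  rw [← ZMod.natCast_zmod_val r] at h ⊢
  rw [map_natCast, Ne, ZMod.natCast_eq_zero_iff] at h
  exact isUnit_natCast_zmod_sq Fact.out h

/-- Euler's criterion lifted to a congruence modulo `p ^ 2`. -/
theorem two_mul_quadraticChar_castHom {p m : ℕ} [Fact p.Prime] (hm : p = 2 * m + 1)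
    (hm2 : 2 ≤ m) (r : ZMod (p ^ 2)) :
    2 * ((quadraticChar (ZMod p) (ZMod.castHom (dvd_pow_self p two_ne_zero) (ZMod p) r) : ℤ) :
      ZMod (p ^ 2)) = 3 * r ^ m - r ^ (3 * m) := by
  set π := ZMod.castHom (dvd_pow_self p two_ne_zero) (ZMod p) with hπ
  by_cases h : π r = 0
  · have h2 := sq_eq_zero_of_castHom_eq_zero h
    rw [h, pow_eq_zero_of_le hm2 h2, pow_eq_zero_of_le (by omega) h2]
    simp
  · have hc : ringChar (ZMod p) ≠ 2 := by
      rw [ZMod.ringChar_zmod_n]; omega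
    have h1 := quadraticChar_eq_pow_of_char_ne_two' hc (π r)
    rw [ZMod.card, show p / 2 = m by omega] at h1
    have h2 : ((quadraticChar (ZMod p) (π r) : ℤ) : ZMod (p ^ 2)) ^ 2 = 1 := by
      exact_mod_cast congrArg (Int.cast : ℤ → ZMod (p ^ 2)) (quadraticChar_sq_one h)
    have h3 : (r ^ m - ((quadraticChar (ZMod p) (π r) : ℤ) : ZMod (p ^ 2))) ^ 2 = 0 := by
      apply sq_eq_zero_of_castHom_eq_zero
      rw [map_sub, map_pow, map_intCast, ← hπ, h1, sub_self]
    rw [mul_comm 3 m, pow_mul]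
    generalize ((quadraticChar (ZMod p) (π r) : ℤ) : ZMod (p ^ 2)) = c at *
    generalize r ^ m = s at *
    linear_combination (3 * s - 2 * c) * h2 + (s + 2 * c) * h3

theorem exists_root_of_unity_zmod_sq (p : ℕ) [Fact p.Prime] :
    ∃ (ζ : ZMod (p ^ 2)) (g : (ZMod p)ˣ), ζ ^ (p - 1) = 1 ∧
      ZMod.castHom (dvd_pow_self p two_ne_zero) (ZMod p) ζ = g ∧
      ∀ x, x ∈ Subgroup.zpowers g := by
  obtain ⟨g, hg⟩ := IsCyclic.exists_generator (α := (ZMod p)ˣ)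
  have hp : p.Prime := Fact.out
  refine ⟨((g : ZMod p).val : ZMod (p ^ 2)) ^ p, g, ?_, ?_, hg⟩
  · have hu : IsUnit ((g : ZMod p).val : ZMod (p ^ 2)) := by
      refine isUnit_natCast_zmod_sq hp fun h => ?_
      rw [← ZMod.natCast_eq_zero_iff, ZMod.natCast_zmod_val] at h
      exact g.ne_zero h
    obtain ⟨u, hu⟩ := hu
    rw [← hu, ← pow_mul]
    have := ZMod.pow_totient u
    rw [Nat.totient_prime_pow hp two_pos, show 2 - 1 = 1 from rfl, pow_one] at this
    rw [← Units.val_pow_eq_pow_val, this, Units.val_one]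
  · rw [map_pow, map_natCast, ZMod.natCast_zmod_val, ZMod.pow_card]

theorem sum_pow_mul_root_of_unity {p : ℕ} [Fact p.Prime] {ζ : ZMod (p ^ 2)} {g : (ZMod p)ˣ}
    (hζ : ζ ^ (p - 1) = 1) (hζg : ZMod.castHom (dvd_pow_self p two_ne_zero) (ZMod p) ζ = g)
    (hg : ∀ x, x ∈ Subgroup.zpowers g) (k : ℕ) :
    ∑ j ∈ range (p - 1), ζ ^ (j * k) = if p - 1 ∣ k then ((p - 1 : ℕ) : ZMod (p ^ 2)) else 0 := by
  split_ifs with h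
  · obtain ⟨c, rfl⟩ := h
    have : ∀ j ∈ range (p - 1), ζ ^ (j * ((p - 1) * c)) = 1 := fun j _ => by
      rw [show j * ((p - 1) * c) = (p - 1) * (j * c) by ring, pow_mul, hζ, one_pow]
    rw [sum_congr rfl this]
    simp
  · have hu : IsUnit (ζ ^ k - 1) := by
      apply isUnit_of_castHom_ne_zero
      rw [map_sub, map_pow, hζg, map_one, sub_ne_zero]
      intro h1
      apply h
      have h2 : g ^ k = 1 := by
        ext; push_cast; exact h1
      have := orderOf_dvd_of_pow_eq_one h2
      rwa [orderOf_eq_card_of_forall_mem_zpowers hg, Nat.card_eq_fintype_card,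
        ZMod.card_units] at this
    apply hu.mul_left_cancel
    have : ∀ j ∈ range (p - 1), ζ ^ (j * k) = (ζ ^ k) ^ j := fun j _ => by
      rw [← pow_mul, mul_comm]
    rw [sum_congr rfl this, mul_geom_sum, ← pow_mul, mul_comm k, pow_mul, hζ, one_pow, sub_self,
      mul_zero]

theorem sum_eq_sum_range_generator {p : ℕ} [Fact p.Prime] {M : Type*} [AddCommMonoid M]
    {g : (ZMod p)ˣ} (hg : ∀ x, x ∈ Subgroup.zpowers g) (f : ZMod p → M) (h0 : f 0 = 0) :
    ∑ t, f t = ∑ j ∈ range (p - 1), f ((g : ZMod p) ^ j) := by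
  have hcard : Nat.card (ZMod p)ˣ = p - 1 := by
    rw [Nat.card_eq_fintype_card, ZMod.card_units]
  have h1 : ∑ t, f t = ∑ u : (ZMod p)ˣ, f u := by
    rw [← sum_erase (a := 0) univ h0]
    symm
    refine sum_bij (fun u _ => (u : ZMod p)) ?_ ?_ ?_ ?_
    · intro u _; simp
    · intro u _ v _ h; exact Units.ext h
    · intro t ht
      simp only [mem_erase, mem_univ, and_true] at ht
      exact ⟨Units.mk0 t ht, mem_univ _, rfl⟩
    · intro u _; rfl
  rw [h1, ← IsCyclic.image_range_card hg, sum_image, hcard]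
  · simp
  · rw [← orderOf_eq_card_of_forall_mem_zpowers hg]
    intro i hi j hj h
    simp only [coe_range, Set.mem_Iio] at hi hj
    exact pow_injOn_Iio_orderOf hi hj h

/-- The character sum `∑ χ(t) χ(t² + a)`. -/
def jacobsthalSum (p : ℕ) [Fact p.Prime] (a : ZMod p) : ℤ :=
  ∑ t, quadraticChar (ZMod p) t * quadraticChar (ZMod p) (t ^ 2 + a)

theorem two_mul_jacobsthalSum_one {p n : ℕ} [Fact p.Prime] (hn : p = 4 * n + 1) :
    2 * (jacobsthalSum p 1 : ZMod (p ^ 2)) = ((p : ZMod (p ^ 2)) - 1) *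
      (3 * ((2 * n).choose n : ZMod (p ^ 2)) - 2 * ((6 * n).choose n : ZMod (p ^ 2)) -
        ((6 * n).choose (3 * n) : ZMod (p ^ 2))) := by
  obtain ⟨ζ, g, hζ, hζg, hg⟩ := exists_root_of_unity_zmod_sq p
  have hn0 : 0 < n := by
    rcases Nat.eq_zero_or_pos n with rfl | h
    · exact absurd hn (Fact.out : p.Prime).one_lt.ne'
    · exact h
  have hM (M : ℕ) : ∑ j ∈ range (p - 1), (ζ ^ j * ((ζ ^ j) ^ 2 + 1)) ^ M =
      ∑ i ∈ range (M + 1), (M.choose i : ZMod (p ^ 2)) *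
        (if 4 * n ∣ M + 2 * i then ((4 * n : ℕ) : ZMod (p ^ 2)) else 0) := by
    have h : ∀ j ∈ range (p - 1), (ζ ^ j * ((ζ ^ j) ^ 2 + 1)) ^ M =
        ∑ i ∈ range (M + 1), (M.choose i : ZMod (p ^ 2)) * ζ ^ (j * (M + 2 * i)) := by
      intro j _
      rw [mul_pow, add_pow, mul_sum]
      refine sum_congr rfl fun i _ => ?_
      rw [one_pow, pow_mul ζ j, pow_add (ζ ^ j), pow_mul (ζ ^ j)]
      ring
    rw [sum_congr rfl h, sum_comm]
    refine sum_congr rfl fun i _ => ?_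
    rw [← mul_sum, sum_pow_mul_root_of_unity hζ hζg hg, show p - 1 = 4 * n by omega]
  have h1 : 2 * (jacobsthalSum p 1 : ZMod (p ^ 2)) =
      ∑ j ∈ range (p - 1), (3 * (ζ ^ j * ((ζ ^ j) ^ 2 + 1)) ^ (2 * n) -
        (ζ ^ j * ((ζ ^ j) ^ 2 + 1)) ^ (3 * (2 * n))) := by
    rw [jacobsthalSum, sum_eq_sum_range_generator hg _ (by simp), Int.cast_sum, mul_sum]
    refine sum_congr rfl fun j _ => ?_
    rw [← two_mul_quadraticChar_castHom (by omega) (by omega), ← map_mul]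
    simp only [map_mul, map_add, map_pow, hζg, map_one]
  have h2 : ∑ i ∈ range (2 * n + 1), ((2 * n).choose i : ZMod (p ^ 2)) *
        (if 4 * n ∣ 2 * n + 2 * i then ((4 * n : ℕ) : ZMod (p ^ 2)) else 0) =
      (2 * n).choose n * (4 * n : ℕ) := by
    rw [sum_eq_single_of_mem n (by simp; omega)]
    · rw [if_pos ⟨1, by ring⟩]
    · intro i hi hne
      rw [if_neg, mul_zero]
      rintro ⟨c, hc⟩
      simp only [mem_range] at hi
      have : c < 2 := by nlinarith
      have : 0 < c := by by_contra h; simp at h; subst h; omega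
      have : c = 1 := by omega
      subst this; omega
  have h3 : ∑ i ∈ range (6 * n + 1), ((6 * n).choose i : ZMod (p ^ 2)) *
        (if 4 * n ∣ 6 * n + 2 * i then ((4 * n : ℕ) : ZMod (p ^ 2)) else 0) =
      (2 * (6 * n).choose n + (6 * n).choose (3 * n)) * (4 * n : ℕ) := by
    have hsub : ({n, 3 * n, 5 * n} : Finset ℕ) ⊆ range (6 * n + 1) := by
      intro i; simp only [mem_insert, mem_singleton, mem_range]; omega
    rw [← sum_subset hsub]
    · rw [sum_insert (by simp; omega), sum_insert (by simp; omega), sum_singleton,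
        if_pos ⟨2, by ring⟩, if_pos ⟨3, by ring⟩, if_pos ⟨4, by ring⟩,
        ← Nat.choose_symm_of_eq_add (show 6 * n = n + 5 * n by ring)]
      ring
    · intro i hi hne
      rw [if_neg, mul_zero]
      rintro ⟨c, hc⟩
      simp only [mem_range, mem_insert, mem_singleton, not_or] at hi hne
      have : c < 5 := by nlinarith
      interval_cases c <;> omega
  have hpn : (p : ZMod (p ^ 2)) - 1 = (4 * n : ℕ) := by
    rw [sub_eq_iff_eq_add]
    exact_mod_cast congrArg (Nat.cast : ℕ → ZMod (p ^ 2)) hn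
  rw [h1, sum_sub_distrib, ← mul_sum, hM, hM, show 3 * (2 * n) = 6 * n by ring, h2, h3, hpn]
  ring

theorem prime_mul_factorial_mul_factorial {p : ℕ} [Fact p.Prime] {a b : ℕ} (hab : a + b + 1 = p) :
    (p : ZMod (p ^ 2)) * ((a.factorial : ZMod (p ^ 2)) * b.factorial) =
      p * (-1) ^ (a + 1) := by
  have hsq := natCast_sq_eq_zero_zmod_sq p
  induction a generalizing b with
  | zero =>
    have h : (((p - 1).factorial + 1 : ℕ) : ZMod p) = 0 := by
      push_cast
      rw [ZMod.wilsons_lemma, neg_add_cancel]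
    rw [ZMod.natCast_eq_zero_iff, show p - 1 = b by omega] at h
    obtain ⟨c, hc⟩ := h
    have hc := congrArg (Nat.cast : ℕ → ZMod (p ^ 2)) hc
    push_cast at hc
    simp
    linear_combination (p : ZMod (p ^ 2)) * hc + c * hsq
  | succ a ih =>
    have ih := ih (b := b + 1) (by omega)
    rw [Nat.factorial_succ] at ih ⊢
    have hp := congrArg (Nat.cast : ℕ → ZMod (p ^ 2)) hab
    rw [pow_succ (-1 : ZMod (p ^ 2)) (a + 1)]
    push_cast at hp ih ⊢
    linear_combination -ih - p * (a.factorial * b.factorial : ZMod (p ^ 2)) * (-hp) +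
      (a.factorial * b.factorial : ZMod (p ^ 2)) * hsq

theorem prime_mul_ascFactorial (p k : ℕ) :
    (p : ZMod (p ^ 2)) * ((p + 1).ascFactorial k : ZMod (p ^ 2)) = p * k.factorial := by
  induction k with
  | zero => simp
  | succ k ih =>
    rw [Nat.ascFactorial_succ, Nat.factorial_succ]
    push_cast
    linear_combination (p + 1 + k : ZMod (p ^ 2)) * ih +
      (k.factorial : ZMod (p ^ 2)) * natCast_sq_eq_zero_zmod_sq p

theorem choose_mul_choose_three_mul {p n : ℕ} [Fact p.Prime] (hn : p = 4 * n + 1) :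
    ((2 * n).choose n : ZMod (p ^ 2)) * (6 * n).choose (3 * n) = -2 * p := by
  have hp : p.Prime := Fact.out
  have hsq := natCast_sq_eq_zero_zmod_sq p
  obtain ⟨j, rfl⟩ : ∃ j, n = j + 1 := by
    refine ⟨n - 1, ?_⟩
    have : n ≠ 0 := by rintro rfl; exact hp.one_lt.ne' hn
    omega
  obtain ⟨c, hc⟩ := hp.dvd_choose (show 3 * (j + 1) < p by omega)
    (show 6 * (j + 1) - 3 * (j + 1) < p by omega) (show p ≤ 6 * (j + 1) by omega)
  have hB := Nat.choose_mul_factorial_mul_factorial (show j + 1 ≤ 2 * (j + 1) by omega)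
  have hC := Nat.choose_mul_factorial_mul_factorial (show 3 * (j + 1) ≤ 6 * (j + 1) by omega)
  rw [show 2 * (j + 1) - (j + 1) = j + 1 by omega] at hB
  rw [show 6 * (j + 1) - 3 * (j + 1) = 3 * (j + 1) by omega] at hC
  have hA := Nat.factorial_mul_ascFactorial p (2 * j + 1)
  rw [show p + (2 * j + 1) = 6 * (j + 1) by omega, ← hC] at hA
  have hA' := prime_mul_ascFactorial p (2 * j + 1)
  have hpf : p.factorial = p * (4 * (j + 1)).factorial := by
    rw [hn, Nat.factorial_succ]
  have h2f : (2 * (j + 1)).factorial = 2 * (j + 1) * (2 * j + 1).factorial := by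
    rw [show 2 * (j + 1) = 2 * j + 1 + 1 by ring, Nat.factorial_succ]
  have w1 := prime_mul_factorial_mul_factorial (p := p) (a := j + 1) (b := 3 * (j + 1)) (by omega)
  have w2 := prime_mul_factorial_mul_factorial (p := p) (a := 2 * (j + 1)) (b := 2 * (j + 1))
    (by omega)
  have w3 := prime_mul_factorial_mul_factorial (p := p) (a := 0) (b := 4 * (j + 1)) (by omega)
  rw [pow_succ (-1 : ZMod (p ^ 2)), pow_mul, neg_one_sq, one_pow] at w2
  rw [hpf, hc] at hA
  rw [hc]
  have hpn := congrArg (Nat.cast : ℕ → ZMod (p ^ 2)) hn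
  apply_fun (Nat.cast : ℕ → ZMod (p ^ 2)) at hA hB h2f
  simp only [Nat.factorial_zero] at w3
  have hs : (-1 : ZMod (p ^ 2)) ^ (j + 1 + 1) * (-1) ^ (j + 1 + 1) = 1 := by
    rw [← mul_pow]; simp
  push_cast at *
  generalize (-1 : ZMod (p ^ 2)) ^ (j + 1 + 1) = s at *
  generalize ((j + 1).factorial : ZMod (p ^ 2)) = F1 at *
  generalize ((2 * (j + 1)).factorial : ZMod (p ^ 2)) = F2 at *
  generalize ((3 * (j + 1)).factorial : ZMod (p ^ 2)) = F3 at *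
  generalize ((4 * (j + 1)).factorial : ZMod (p ^ 2)) = F4 at *
  generalize ((2 * j + 1).factorial : ZMod (p ^ 2)) = G at *
  generalize ((p + 1).ascFactorial (2 * j + 1) : ZMod (p ^ 2)) = A at *
  generalize ((2 * (j + 1)).choose (j + 1) : ZMod (p ^ 2)) = B at *
  generalize (p : ZMod (p ^ 2)) = P at *
  generalize (j : ZMod (p ^ 2)) = J at *
  generalize (c : ZMod (p ^ 2)) = C at *
  have k1 : P * (F1 * F3) ^ 2 = P := by
    linear_combination F1 * F3 * w1 + s * w1 + P * hs
  have k2 : P * C * B = B * C * F1 ^ 2 * (P * F3 ^ 2) := by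
    linear_combination -B * C * k1
  have k3 : P * C * B = F2 * (P * F4 * G) := by
    linear_combination k2 + C * P * F3 ^ 2 * hB - F2 * hA + F2 * F4 * hA'
  have k4 : 2 * (J + 1) * (P * C * B) = P := by
    linear_combination 2 * (J + 1) * k3 - F2 * P * F4 * h2f + F4 * w2 - w3
  linear_combination -2 * k4 - P * C * B * hpn + C * B * hsq

theorem sum_range_two_mul_alternating {R : Type*} [CommRing R] (u : ℕ → R) (n : ℕ)
    (hu : ∀ k, 0 < k → k ≤ n → 2 * u (2 * k) = u k) :
    ∑ i ∈ range (2 * n), (-1) ^ i * u (i + 1) = ∑ i ∈ range n, u (n + (i + 1)) := by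
  have h1 : ∑ i ∈ range (2 * n), (-1) ^ i * u (i + 1) =
      ∑ i ∈ range (2 * n), u (i + 1) - ∑ i ∈ range n, u (i + 1) := by
    rw [sum_range_two_mul, sum_range_two_mul, ← sum_sub_distrib]
    refine sum_congr rfl fun i hi => ?_
    simp only [mem_range] at hi
    have := hu (i + 1) (by omega) (by omega)
    rw [show 2 * (i + 1) = 2 * i + 1 + 1 by ring] at this
    rw [pow_succ (-1 : R), pow_mul, neg_one_sq, one_pow, ← this]
    ring
  rw [h1, two_mul, sum_range_add, add_sub_cancel_left]
  rfl

theorem factorial_mul_prod_add (n : ℕ) (hn : 0 < n) :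
    2 * (n.factorial * ∏ i ∈ range n, (n + i)) = (2 * n).factorial := by
  obtain ⟨j, rfl⟩ : ∃ j, n = j + 1 := ⟨n - 1, by omega⟩
  have h := Nat.factorial_mul_ascFactorial j (j + 1)
  rw [← Nat.ascFactorial_eq_prod_range, Nat.factorial_succ,
    show 2 * (j + 1) = j + (j + 1) + 1 by ring, Nat.factorial_succ (j + (j + 1)), ← h]
  ring

theorem two_mul_choose_six_mul {p n : ℕ} [Fact p.Prime] (hn : p = 4 * n + 1) :
    2 * ((6 * n).choose n : ZMod (p ^ 2)) =
      ((2 * n).choose n : ZMod (p ^ 2)) * (1 + 2 * fermatTerm p n - 2 * p) := by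
  have hp : p.Prime := Fact.out
  have hsq := natCast_sq_eq_zero_zmod_sq p
  have hn0 : 0 < n := by
    rcases Nat.eq_zero_or_pos n with rfl | h
    · exact absurd hn hp.one_lt.ne'
    · exact h
  have hu : IsUnit (n.factorial : ZMod (p ^ 2)) := by
    refine isUnit_natCast_zmod_sq hp fun h => ?_
    have := (hp.dvd_factorial).1 h
    omega
  have h6 : ((6 * n).choose n : ZMod (p ^ 2)) * n.factorial =
      ((∏ i ∈ range n, (n + i) : ℕ) : ZMod (p ^ 2)) *
        (1 + p * ∑ i ∈ range n, ((n + i : ℕ) : ZMod (p ^ 2))⁻¹) := by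
    have h := prod_add_mul_of_sq_eq_zero hsq (range n)
      (u := fun i => ((n + i : ℕ) : ZMod (p ^ 2))) (v := fun _ => 1)
      (w := fun i => ((n + i : ℕ) : ZMod (p ^ 2))⁻¹) (by
        intro i hi
        simp only [mem_range] at hi
        exact mul_inv_natCast_zmod_sq hp (by omega) (by omega))
    simp only [one_mul, mul_one] at h
    rw [Nat.cast_prod, ← h, ← Nat.cast_mul, mul_comm, ← Nat.descFactorial_eq_factorial_mul_choose,
      Nat.descFactorial_eq_prod_range, Nat.cast_prod, ← prod_range_reflect]
    refine prod_congr rfl fun i hi => ?_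
    simp only [mem_range] at hi
    rw [show 6 * n - (n - 1 - i) = n + i + p by omega]
    push_cast
    ring
  have hfac := congrArg (Nat.cast : ℕ → ZMod (p ^ 2)) (factorial_mul_prod_add n hn0)
  have hB := congrArg (Nat.cast : ℕ → ZMod (p ^ 2))
    (Nat.choose_mul_factorial_mul_factorial (show n ≤ 2 * n by omega))
  rw [show 2 * n - n = n by omega] at hB
  have hinv (k : ℕ) (h0 : 0 < k) (hk : k ≤ 2 * n) : 2 * ((2 * k : ℕ) : ZMod (p ^ 2))⁻¹ =
      (k : ZMod (p ^ 2))⁻¹ := by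
    have h1 := mul_inv_natCast_zmod_sq (a := k) hp (by omega) (by omega)
    have h2 := mul_inv_natCast_zmod_sq (a := 2 * k) hp (by omega) (by omega)
    push_cast at h2 ⊢
    linear_combination (k : ZMod (p ^ 2))⁻¹ * h2 - 2 * (2 * (k : ZMod (p ^ 2)))⁻¹ * h1
  have hg : 2 * fermatTerm p n = p * ∑ i ∈ range n, ((n + (i + 1) : ℕ) : ZMod (p ^ 2))⁻¹ := by
    rw [fermatTerm, ← sum_range_two_mul_alternating (fun k : ℕ => (k : ZMod (p ^ 2))⁻¹) n
      (fun k h0 hk => hinv k h0 (by omega)), mul_left_comm, mul_sum]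
    congr 1
    refine sum_congr rfl fun i hi => ?_
    simp only [mem_range] at hi
    rw [mul_left_comm, hinv _ (by omega) (by omega)]
  have hsh : ∑ i ∈ range n, ((n + i : ℕ) : ZMod (p ^ 2))⁻¹ =
      ∑ i ∈ range n, ((n + (i + 1) : ℕ) : ZMod (p ^ 2))⁻¹ + (n : ZMod (p ^ 2))⁻¹ -
        ((n + n : ℕ) : ZMod (p ^ 2))⁻¹ := by
    have h1 := sum_range_succ (fun i => ((n + i : ℕ) : ZMod (p ^ 2))⁻¹) n
    rw [sum_range_succ'] at h1
    rw [add_zero] at h1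
    linear_combination -h1
  have hpn : (p : ZMod (p ^ 2)) = 4 * n + 1 := by
    exact_mod_cast congrArg (Nat.cast : ℕ → ZMod (p ^ 2)) hn
  have h2n := hinv n hn0 (by omega)
  have h1n := mul_inv_natCast_zmod_sq (a := 2 * n) hp (by omega) (by omega)
  rw [← two_mul] at hsh
  rw [hsh, ← h2n] at h6
  rw [hg]
  apply (hu.mul hu).mul_left_cancel
  push_cast at *
  generalize ∑ i ∈ range n, ((n : ZMod (p ^ 2)) + (i + 1))⁻¹ = S at *
  generalize ∏ i ∈ range n, ((n : ZMod (p ^ 2)) + i) = P at *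
  generalize (n.factorial : ZMod (p ^ 2)) = F at *
  generalize (2 * (n : ZMod (p ^ 2)))⁻¹ = v at *
  have hv : p * v = -2 * p := by
    linear_combination -2 * p * h1n - p * v * hpn + v * hsq
  linear_combination 2 * F * h6 + (1 + p * S + p * v) * hfac - (1 + p * S - 2 * p) * hB +
    (2 * n).factorial * hv

/-- The Jacobsthal sum modulo `p ^ 2`. -/
theorem jacobsthalSum_one_sq_eq {p n : ℕ} [Fact p.Prime] (hn : p = 4 * n + 1) :
    (jacobsthalSum p 1 : ZMod (p ^ 2)) ^ 2 =
      ((2 * n).choose n : ZMod (p ^ 2)) ^ 2 * (1 - 2 * fermatTerm p n) + 2 * p := by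
  have hp : p.Prime := Fact.out
  have hn0 : n ≠ 0 := by rintro rfl; exact hp.one_lt.ne' hn
  have h1 := two_mul_jacobsthalSum_one hn
  have h2 := two_mul_choose_six_mul hn
  have h3 := choose_mul_choose_three_mul hn
  have hsq := natCast_sq_eq_zero_zmod_sq p
  have hg := fermatTerm_sq p n
  have hpg := mul_fermatTerm_self p n
  have hK : ((6 * n).choose (3 * n) : ZMod (p ^ 2)) ^ 2 = 0 :=
    natCast_sq_eq_zero_of_dvd (hp.dvd_choose (by omega) (by omega) (by omega))
  have h4 : IsUnit (4 : ZMod (p ^ 2)) := by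
    have := (isUnit_natCast_zmod_sq_of_lt (a := 2) hp (by omega) (by omega)).pow 2
    norm_num at this
    exact this
  apply h4.mul_left_cancel
  generalize (jacobsthalSum p 1 : ZMod (p ^ 2)) = φ at *
  generalize fermatTerm p n = g at *
  generalize ((2 * n).choose n : ZMod (p ^ 2)) = B at *
  generalize ((6 * n).choose (3 * n) : ZMod (p ^ 2)) = K at *
  generalize (p : ZMod (p ^ 2)) = P at *
  have h5 : 2 * φ = (P - 1) * (2 * B * (1 - g + P) - K) := by
    rw [h1, h2]; ring
  have h6 : 4 * φ ^ 2 = ((P - 1) * (2 * B * (1 - g + P) - K)) ^ 2 := by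
    rw [← h5]; ring
  have h7 : (P - 1) ^ 2 * (1 - g + P) ^ 2 = 1 - 2 * g := by
    have e1 : (1 - g + P) ^ 2 = 1 - 2 * g + 2 * P := by linear_combination hg + hsq - 2 * hpg
    rw [e1]
    linear_combination (2 * P - 3 - 2 * g) * hsq + 4 * hpg
  have h8 : P * (P - 1) ^ 2 * (1 - g + P) = P := by
    linear_combination ((P - 2) * (1 - g + P) + 1) * hsq - hpg
  linear_combination h6 + 4 * B ^ 2 * h7 + 8 * h8 - 4 * (P - 1) ^ 2 * (1 - g + P) * h3 +
    (P - 1) ^ 2 * hK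

theorem jacobsthalSum_mul_sq {p : ℕ} [Fact p.Prime] (a : ZMod p) {k : ZMod p} (hk : k ≠ 0) :
    jacobsthalSum p (a * k ^ 2) = quadraticChar (ZMod p) k * jacobsthalSum p a := by
  rw [jacobsthalSum, jacobsthalSum, mul_sum, ← Equiv.sum_comp (Equiv.mulLeft₀ k hk)]
  refine sum_congr rfl fun t _ => ?_
  rw [Equiv.mulLeft₀_apply, show (k * t) ^ 2 + a * k ^ 2 = k ^ 2 * (t ^ 2 + a) by ring, map_mul,
    map_mul, quadraticChar_sq_one' hk]
  ring

theorem jacobsthalSum_zero {p : ℕ} [Fact p.Prime] (hp2 : p ≠ 2) : jacobsthalSum p 0 = 0 := by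
  rw [jacobsthalSum, ← quadraticChar_sum_zero (F := ZMod p) (by rwa [ZMod.ringChar_zmod_n])]
  refine sum_congr rfl fun t _ => ?_
  rcases eq_or_ne t 0 with rfl | h
  · simp
  · rw [add_zero, quadraticChar_sq_one' h, mul_one]

theorem sum_quadraticChar_mul_add {p : ℕ} [Fact p.Prime] (hp2 : p ≠ 2) {d : ZMod p} (hd : d ≠ 0) :
    ∑ b, quadraticChar (ZMod p) b * quadraticChar (ZMod p) (b + d) = -1 := by
  have h0 : ∑ c : ZMod p, quadraticChar (ZMod p) (c + 1) = 0 := by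
    rw [← quadraticChar_sum_zero (F := ZMod p) (by rwa [ZMod.ringChar_zmod_n])]
    exact Equiv.sum_comp (Equiv.addRight (1 : ZMod p)) (fun c => quadraticChar (ZMod p) c)
  rw [← Equiv.sum_comp (Equiv.mulLeft₀ d hd)] at h0
  rw [← Equiv.sum_comp (Equiv.inv (ZMod p)), ← add_sum_erase univ _ (mem_univ (0 : ZMod p))] at h0
  rw [← add_sum_erase univ _ (mem_univ (0 : ZMod p))]
  simp only [Equiv.inv_apply, inv_zero, Equiv.mulLeft₀_apply, mul_zero, zero_add, map_one,
    MulChar.map_zero, zero_mul] at h0 ⊢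
  rw [← eq_neg_iff_add_eq_zero, eq_comm, neg_eq_iff_eq_neg] at h0
  rw [← h0]
  refine sum_congr rfl fun b hb => ?_
  simp only [mem_erase, mem_univ, and_true] at hb
  rw [show b + d = b * (d * b⁻¹ + 1) by field_simp; ring, map_mul, ← mul_assoc, ← sq,
    quadraticChar_sq_one hb, one_mul]

theorem sum_quadraticChar_add_mul_add {p : ℕ} [Fact p.Prime] (hp2 : p ≠ 2) (u v : ZMod p) :
    ∑ a, quadraticChar (ZMod p) (u + a) * quadraticChar (ZMod p) (v + a) =
      (if u = v then (p : ℤ) else 0) - 1 := by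
  split_ifs with h
  · subst h
    have h := Equiv.sum_comp (Equiv.addLeft u)
      fun a => quadraticChar (ZMod p) a * quadraticChar (ZMod p) a
    simp only [Equiv.coe_addLeft] at h
    rw [h, ← add_sum_erase univ _ (mem_univ (0 : ZMod p)),
      sum_congr rfl (g := fun _ => (1 : ℤ)) fun b hb => by
        simp only [mem_erase, mem_univ, and_true] at hb
        rw [← sq, quadraticChar_sq_one hb]]
    rw [sum_const, card_erase_of_mem (mem_univ _), card_univ, ZMod.card]
    simp [(Fact.out : p.Prime).one_le]
  · rw [zero_sub, ← sum_quadraticChar_mul_add hp2 (sub_ne_zero.2 (Ne.symm h)),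
      ← Equiv.sum_comp (Equiv.addLeft u)
        (fun b => quadraticChar (ZMod p) b * quadraticChar (ZMod p) (b + (v - u)))]
    refine sum_congr rfl fun a _ => ?_
    rw [Equiv.coe_addLeft, show u + a + (v - u) = v + a by ring]

theorem quadraticChar_neg_of_mod_four {p : ℕ} [Fact p.Prime] (h4 : p % 4 = 1) (t : ZMod p) :
    quadraticChar (ZMod p) (-t) = quadraticChar (ZMod p) t := by
  have h : IsSquare (-1 : ZMod p) := ZMod.exists_sq_eq_neg_one_iff.2 (by omega)
  rw [neg_eq_neg_one_mul, map_mul,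
    (quadraticChar_one_iff_isSquare (neg_ne_zero.2 one_ne_zero)).2 h, one_mul]

theorem sum_jacobsthalSum_sq {p : ℕ} [Fact p.Prime] (h4 : p % 4 = 1) :
    ∑ a, jacobsthalSum p a ^ 2 = 2 * p * (p - 1) := by
  have hp2 : p ≠ 2 := by rintro rfl; omega
  have h0 := quadraticChar_sum_zero (F := ZMod p) (by rwa [ZMod.ringChar_zmod_n])
  have h1 : ∑ a, jacobsthalSum p a ^ 2 = ∑ s, ∑ t,
      quadraticChar (ZMod p) s * quadraticChar (ZMod p) t *
        ((if s ^ 2 = t ^ 2 then (p : ℤ) else 0) - 1) := by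
    have h (a : ZMod p) : jacobsthalSum p a ^ 2 = ∑ s, ∑ t,
        quadraticChar (ZMod p) s * quadraticChar (ZMod p) (s ^ 2 + a) *
          (quadraticChar (ZMod p) t * quadraticChar (ZMod p) (t ^ 2 + a)) := by
      rw [sq, jacobsthalSum, sum_mul_sum]
    simp only [h]
    rw [sum_comm]
    refine sum_congr rfl fun s _ => ?_
    rw [sum_comm]
    refine sum_congr rfl fun t _ => ?_
    rw [← sum_quadraticChar_add_mul_add hp2, mul_sum]
    refine sum_congr rfl fun a _ => ?_
    ring
  have h2 (s : ZMod p) : ∑ t, quadraticChar (ZMod p) s * quadraticChar (ZMod p) t *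
        ((if s ^ 2 = t ^ 2 then (p : ℤ) else 0) - 1) = if s = 0 then (0 : ℤ) else 2 * (p : ℤ) := by
    simp only [mul_sub, mul_one, sum_sub_distrib]
    rw [← mul_sum, h0, mul_zero, sub_zero]
    split_ifs with hs
    · simp [hs]
    · have hne : s ≠ -s := by
        intro h
        have : (2 : ZMod p) * s = 0 := by linear_combination h
        rcases mul_eq_zero.1 this with h | h
        · have h' : ((2 : ℕ) : ZMod p) = 0 := by exact_mod_cast h
          rw [ZMod.natCast_eq_zero_iff] at h'
          exact hp2 ((Nat.prime_dvd_prime_iff_eq Fact.out Nat.prime_two).1 h')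
        · exact hs h
      rw [← sum_subset (subset_univ {s, -s}), sum_pair hne]
      · rw [quadraticChar_neg_of_mod_four h4, neg_sq, ← sq, quadraticChar_sq_one hs]
        simp
        ring
      · intro t _ ht
        simp only [mem_insert, mem_singleton, not_or] at ht
        rw [if_neg, mul_zero]
        intro h
        rcases sq_eq_sq_iff_eq_or_eq_neg.1 h with h | h
        · exact ht.1 h.symm
        · exact ht.2 (by rw [h, neg_neg])
  rw [h1, sum_congr rfl fun s _ => h2 s, ← add_sum_erase univ _ (mem_univ (0 : ZMod p)), if_pos rfl,
    sum_congr rfl (g := fun _ => (2 * p : ℤ)) fun s hs => if_neg (ne_of_mem_erase hs), sum_const,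
    card_erase_of_mem (mem_univ _), card_univ, ZMod.card, nsmul_eq_mul,
    Nat.cast_sub (Fact.out : p.Prime).one_le]
  push_cast
  ring

theorem jacobsthalSum_one_sq_add_sq {p : ℕ} [Fact p.Prime] (h4 : p % 4 = 1) :
    ∃ r : ZMod p, jacobsthalSum p 1 ^ 2 + jacobsthalSum p r ^ 2 = 4 * p := by
  have hp2 : p ≠ 2 := by rintro rfl; omega
  obtain ⟨g, hg⟩ := IsCyclic.exists_generator (α := (ZMod p)ˣ)
  refine ⟨g, ?_⟩
  have h := sum_jacobsthalSum_sq h4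
  rw [sum_eq_sum_range_generator hg _ (by rw [jacobsthalSum_zero hp2]; rfl),
    show p - 1 = 2 * (p / 2) by omega, sum_range_two_mul,
    sum_congr rfl (g := fun _ => jacobsthalSum p 1 ^ 2 + jacobsthalSum p g ^ 2)] at h
  · rw [sum_const, card_range, nsmul_eq_mul] at h
    have h1 : (p : ℤ) - 1 = 2 * (p / 2 : ℕ) := by omega
    have h0 : ((p / 2 : ℕ) : ℤ) ≠ 0 := by
      have := (Fact.out : p.Prime).two_le
      omega
    apply mul_left_cancel₀ h0
    rw [h, h1]
    ring
  · intro i _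
    have hi : (g : ZMod p) ^ i ≠ 0 := pow_ne_zero _ g.ne_zero
    rw [show (g : ZMod p) ^ (2 * i) = 1 * ((g : ZMod p) ^ i) ^ 2 by ring,
      show (g : ZMod p) ^ (2 * i + 1) = g * ((g : ZMod p) ^ i) ^ 2 by ring,
      jacobsthalSum_mul_sq _ hi, jacobsthalSum_mul_sq _ hi, mul_pow, mul_pow,
      quadraticChar_sq_one hi, one_mul, one_mul]

theorem jacobsthalSum_one_emod_four {p : ℕ} [Fact p.Prime] (h4 : p % 4 = 1) :
    jacobsthalSum p 1 % 4 = 2 := by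
  have hp2 : p ≠ 2 := by rintro rfl; omega
  have h20 : (2 : ZMod p) ≠ 0 := by
    intro h
    have h' : ((2 : ℕ) : ZMod p) = 0 := by exact_mod_cast h
    rw [ZMod.natCast_eq_zero_iff] at h'
    exact hp2 ((Nat.prime_dvd_prime_iff_eq Fact.out Nat.prime_two).1 h')
  obtain ⟨i, hi⟩ : IsSquare (-1 : ZMod p) := ZMod.exists_sq_eq_neg_one_iff.2 (by omega)
  have hi0 : i ≠ 0 := by rintro rfl; simp at hi
  set f : ZMod p → ℤ := fun t => quadraticChar (ZMod p) t * quadraticChar (ZMod p) (t ^ 2 + 1)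
    with hf
  have hneg (t : ZMod p) : f (-t) = f t := by
    simp only [hf, neg_sq, quadraticChar_neg_of_mod_four h4]
  have hval (t : ZMod p) : f t = 0 ∨ f t = 1 ∨ f t = -1 := by
    simp only [hf, ← map_mul]
    rcases eq_or_ne (t * (t ^ 2 + 1)) 0 with h | h
    · rw [h]; simp
    · exact Or.inr (quadraticChar_dichotomy h)
  have hcount : ∑ t, (1 - f t ^ 2) = 3 := by
    rw [← sum_subset (subset_univ {0, i, -i})]
    · have hne : i ≠ -i := by
        intro h
        have : (2 : ZMod p) * i = 0 := by linear_combination h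
        rcases mul_eq_zero.1 this with h | h
        exacts [h20 h, hi0 h]
      have hfi : f i = 0 := by
        simp only [hf, show i ^ 2 + 1 = 0 by linear_combination -hi]
        simp
      rw [sum_insert (by simp [hi0.symm, hi0]), sum_pair hne, hneg, hfi]
      simp [hf]
    · intro t _ ht
      simp only [mem_insert, mem_singleton, not_or] at ht
      have h : t * (t ^ 2 + 1) ≠ 0 := by
        refine mul_ne_zero ht.1 fun h => ?_
        have : (t - i) * (t + i) = 0 := by linear_combination h + hi
        rcases mul_eq_zero.1 this with h | h
        · exact ht.2.1 (sub_eq_zero.1 h)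
        · exact ht.2.2 (eq_neg_of_add_eq_zero_left h)
      simp only [hf, ← map_mul, quadraticChar_sq_one h, sub_self]
  have hzero : ∑ t, ((f t - f t ^ 2 : ℤ) : ZMod 4) = 0 := by
    refine sum_involution (fun t _ => -t) ?_ ?_ (fun _ _ => mem_univ _) (fun _ _ => neg_neg _)
    · intro t _
      rw [hneg]
      rcases hval t with h | h | h <;> rw [h] <;> decide
    · intro t _ hne h
      apply hne
      have : (2 : ZMod p) * t = 0 := by linear_combination -h
      rcases mul_eq_zero.1 this with h | h
      · exact absurd h h20
      · simp [hf, h]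
  rw [← Int.cast_sum, ZMod.intCast_zmod_eq_zero_iff_dvd, sum_sub_distrib] at hzero
  rw [sum_sub_distrib, sum_const, card_univ, ZMod.card, nsmul_eq_mul, mul_one] at hcount
  have : jacobsthalSum p 1 = ∑ t, f t := rfl
  omega

theorem sq_eq_sq_of_sq_add_sq_eq_prime {p : ℕ} (hp : p.Prime) {x y X Y : ℤ}
    (h : (p : ℤ) = x ^ 2 + y ^ 2) (H : (p : ℤ) = X ^ 2 + Y ^ 2) (hx : Odd x) (hy : Even y)
    (hX : Odd X) : X ^ 2 = x ^ 2 := by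
  have hp0 : (p : ℤ) ≠ 0 := by exact_mod_cast hp.ne_zero
  have key (Y : ℤ) (H : (p : ℤ) = X ^ 2 + Y ^ 2) (hd : (p : ℤ) ∣ x * X - y * Y) :
      X ^ 2 = x ^ 2 := by
    obtain ⟨k, hk⟩ := hd
    have h1 : (p * k) ^ 2 + (x * Y + y * X) ^ 2 = (p : ℤ) ^ 2 := by
      rw [← hk]
      linear_combination (-(X ^ 2 + Y ^ 2)) * h - p * H
    have hk0 : k ≠ 0 := by
      rintro rfl
      rw [mul_zero, sub_eq_zero] at hk
      have h2 : Odd (x * X) := hx.mul hX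
      rw [hk, ← Int.not_even_iff_odd] at h2
      exact h2 (hy.mul_right Y)
    have hk2 : k ^ 2 = 1 := by
      have h3 : 0 < k ^ 2 := by positivity
      have h4 : (p : ℤ) ^ 2 * k ^ 2 ≤ (p : ℤ) ^ 2 * 1 := by nlinarith [sq_nonneg (x * Y + y * X)]
      have h5 := le_of_mul_le_mul_left h4 (by positivity)
      omega
    have h6 : x * Y + y * X = 0 := by
      have : (x * Y + y * X) ^ 2 = 0 := by
        linear_combination h1 - (p : ℤ) ^ 2 * hk2
      exact pow_eq_zero_iff two_ne_zero |>.1 this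
    have h7 : X = k * x := by
      apply mul_left_cancel₀ hp0
      linear_combination X * h + x * hk + y * h6
    rw [h7, mul_pow, hk2, one_mul]
  have hd : (p : ℤ) ∣ (x * X - y * Y) * (x * X - y * (-Y)) := by
    refine ⟨x ^ 2 + X ^ 2 - p, ?_⟩
    linear_combination Y ^ 2 * h + (p - x ^ 2) * H
  rcases (Nat.prime_iff_prime_int.1 hp).dvd_or_dvd hd with hd | hd
  · exact key Y H hd
  · exact key (-Y) (by rw [H, neg_sq]) hd

theorem jacobsthalSum_one_sq {p : ℕ} [Fact p.Prime] (h4 : p % 4 = 1) {x y : ℤ}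
    (h : (p : ℤ) = x ^ 2 + y ^ 2) (hx : Odd x) (hy : Even y) :
    jacobsthalSum p 1 ^ 2 = 4 * x ^ 2 := by
  obtain ⟨r, hr⟩ := jacobsthalSum_one_sq_add_sq h4
  have h1 := jacobsthalSum_one_emod_four h4
  obtain ⟨X, hX⟩ : ∃ X, jacobsthalSum p 1 = 2 * X := ⟨jacobsthalSum p 1 / 2, by omega⟩
  have hXo : Odd X := Int.odd_iff.2 (by omega)
  have hY : Even (jacobsthalSum p r) := by
    have : Even (jacobsthalSum p r ^ 2) := ⟨2 * p - 2 * X ^ 2, by rw [hX] at hr; linarith⟩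
    exact (Int.even_pow.1 this).1
  obtain ⟨Y, hY⟩ := hY
  rw [hX, hY] at hr
  rw [hX, ← sq_eq_sq_of_sq_add_sq_eq_prime Fact.out h (Y := Y) (by linarith) hx hy hXo]
  ring

theorem exists_two_mul_eq_one_padicInt {p : ℕ} [Fact p.Prime] (hp2 : p ≠ 2) :
    ∃ v : ℤ_[p], 2 * v = 1 := by
  have h : IsUnit ((2 : ℕ) : ℤ_[p]) := by
    rw [PadicInt.isUnit_iff, PadicInt.norm_natCast_eq_one_iff]
    exact (Nat.coprime_primes Fact.out Nat.prime_two).2 hp2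
  obtain ⟨v, hv⟩ := h.exists_right_inv
  exact ⟨v, by exact_mod_cast hv⟩

/-- For any odd prime `p`,
`∑_{k=0}^{p-1} (-1)^k A_k(-2) ≡ ∑_{k=0}^{p-1} (-1)^k A_k(1/4) (mod p²)` in `ℤ_p`, and
both sums are `≡ 4x² - 2p (mod p²)` whenever `p ≡ 1 (mod 4)` and `p = x² + y²` with `x`
odd and `y` even, and `≡ 0 (mod p²)` when `p ≡ 3 (mod 4)`. -/
theorem sum_apery_neg_two (p : ℕ) [Fact p.Prime] (hp2 : p ≠ 2) :
    (∃ z : ℤ_[p],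
      (∑ k ∈ Finset.range p, (-1 : ℚ_[p]) ^ k * aperyPoly k (-2 : ℚ_[p])) -
        (∑ k ∈ Finset.range p, (-1 : ℚ_[p]) ^ k * aperyPoly k (1 / 4 : ℚ_[p])) =
      (p : ℚ_[p]) ^ 2 * z) ∧
    (p % 4 = 1 → ∀ x y : ℤ, (p : ℤ) = x ^ 2 + y ^ 2 → Odd x → Even y →
      ∃ z : ℤ_[p],
        (∑ k ∈ Finset.range p, (-1 : ℚ_[p]) ^ k * aperyPoly k (-2 : ℚ_[p])) -
          ((4 * x ^ 2 - 2 * p : ℤ) : ℚ_[p]) = (p : ℚ_[p]) ^ 2 * z) ∧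
    (p % 4 = 3 →
      ∃ z : ℤ_[p],
        (∑ k ∈ Finset.range p, (-1 : ℚ_[p]) ^ k * aperyPoly k (-2 : ℚ_[p])) =
          (p : ℚ_[p]) ^ 2 * z) := by
  have hp : p.Prime := Fact.out
  obtain ⟨m, hm⟩ : ∃ m, p = 2 * m + 1 := hp.odd_of_ne_two hp2
  obtain ⟨v, hv⟩ := exists_two_mul_eq_one_padicInt hp2
  have hy : 2 * -PadicInt.toZModPow 2 v = -1 := by
    have h := congrArg (PadicInt.toZModPow 2) hv
    rw [map_mul, map_ofNat, map_one] at h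
    rw [mul_neg, h]
  obtain ⟨a, ha, ha'⟩ := exists_sum_aperyPoly_padicInt hm (w := -2) (y := 1) (by
    rw [map_neg, map_ofNat]
    norm_num)
  obtain ⟨b, hb, hb'⟩ := exists_sum_aperyPoly_padicInt hm (w := v ^ 2)
    (y := -PadicInt.toZModPow 2 v) (by
      rw [map_pow]
      linear_combination -PadicInt.toZModPow 2 v * hy)
  have hv4 : ((v ^ 2 : ℤ_[p]) : ℚ_[p]) = 1 / 4 := by
    have h : (2 : ℚ_[p]) * v = 1 := by exact_mod_cast congrArg (fun t : ℤ_[p] => (t : ℚ_[p])) hv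
    rw [PadicInt.coe_pow, eq_div_iff (by norm_num)]
    linear_combination (2 * (v : ℚ_[p]) + 1) * h
  have h2 : ((-2 : ℤ_[p]) : ℚ_[p]) = -2 := by push_cast; rfl
  rw [hv4] at hb
  rw [h2] at ha
  rw [eval_one_delannoyPoly] at ha'
  rw [← ha, ← hb]
  refine ⟨exists_eq_sq_mul_of_toZModPow_eq ?_, fun h4 x y h hx hy => ?_, fun h4 => ?_⟩
  · rw [ha', hb']
    rcases Nat.even_or_odd m with ⟨n, hn⟩ | hodd
    · have hn' : p = 4 * n + 1 := by omega
      rw [show m = 2 * n by omega, lemniscaticSum_two_mul_sq hp hn',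
        eval_delannoyPoly_sq_eq hp hn' hy]
    · rw [natCast_sq_eq_zero_of_dvd (dvd_lemniscaticSum hp hm hodd)]
      obtain ⟨j, rfl⟩ := hodd
      rw [eval_delannoyPoly_odd hp hy (by omega), zero_pow two_ne_zero]
  · obtain ⟨n, hn⟩ : ∃ n, p = 4 * n + 1 := ⟨p / 4, by omega⟩
    rw [← PadicInt.coe_intCast]
    apply exists_eq_sq_mul_of_toZModPow_eq
    rw [ha', show m = 2 * n by omega, lemniscaticSum_two_mul_sq hp hn, map_intCast]
    have h1 := jacobsthalSum_one_sq_eq hn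
    rw [← Int.cast_pow, jacobsthalSum_one_sq h4 h hx hy] at h1
    push_cast at h1 ⊢
    linear_combination -h1
  · obtain ⟨z, hz⟩ := exists_eq_sq_mul_of_toZModPow_eq (a := a) (b := 0) (by
      rw [ha', natCast_sq_eq_zero_of_dvd (dvd_lemniscaticSum hp hm (Nat.odd_iff.2 (by omega))),
        map_zero])
    exact ⟨z, by simpa using hz⟩
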